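/- arXiv:0901.1652 — 2 statements merged into one kernel-verified Lean document; each statement's English description precedes it below -/
import Mathlib

section
/- The partition function of the reduced H^{2|2} model equals one: for every finite nonempty set V, every symmetric matrix of weights W : V×V → [0,∞) with zero diagonal, and every family ε : V → (0,∞), one has ∫_{ℝ^V} e^{−F(t)} ∏_{k∈V} dt_k/√(2π) = 1, where for t : V → ℝ, D(t) is the symmetric positive-definite operator on ℝ^V with quadratic form [v; D(t) v] = Σ_{i<j} W_{ij} e^{t_i+t_j}(v_i − v_j)² + Σ_{k∈V} ε_k e^{t_k} v_k², and F(t) = Σ_{i<j} W_{ij}(cosh(t_i − t_j) − 1) − (1/2) log det D(t) + Σ_{k∈V} (t_k − ε_k + ε_k cosh t_k). -/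
open scoped BigOperators
open MeasureTheory

noncomputable section

/-- The matrix of the symmetric operator `D(t)` on `ℝ^V` with quadratic form
`[v; D(t) v] = ∑_{i<j} W_{ij} e^{t_i+t_j}(v_i - v_j)² + ∑_k ε_k e^{t_k} v_k²`. -/
def Dmat0 {V : Type*} [Fintype V] [DecidableEq V] (W : V → V → ℝ) (ε : V → ℝ)
    (t : V → ℝ) : Matrix V V ℝ :=
  Matrix.of fun j k =>
    if j = k then (∑ i : V, W i j * Real.exp (t i + t j)) + ε j * Real.exp (t j)
    else -(W j k * Real.exp (t j + t k))

/-- The free energy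
`F(t) = ∑_{i<j} W_{ij}(cosh(t_i - t_j) - 1) - (1/2) log det D(t)
        + ∑_k (t_k - ε_k + ε_k cosh t_k)`
(the sum over unordered pairs `{i,j}` is written as half the sum over ordered pairs;
this is the same since `W` is symmetric with zero diagonal). -/
def F0 {V : Type*} [Fintype V] [DecidableEq V] (W : V → V → ℝ) (ε : V → ℝ)
    (t : V → ℝ) : ℝ :=
  (1 / 2) * (∑ i : V, ∑ j : V, W i j * (Real.cosh (t i - t j) - 1))
    - (1 / 2) * Real.log (Dmat0 W ε t).det
    + ∑ k : V, (t k - ε k + ε k * Real.cosh (t k))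

lemma one_dim (K : ℝ) (hK : 0 < K) :
    ∫⁻ s : ℝ, ENNReal.ofReal (Real.exp (s / 2 + K - K ^ 2 / (2 * Real.exp s) - Real.exp s / 2))
      = ENNReal.ofReal (Real.sqrt (2 * Real.pi)) := by
  set φ : ℝ → ℝ := fun v => Real.exp (-(1 / 2) * v ^ 2) with hφ
  set v : ℝ → ℝ := fun s => Real.exp (s / 2) - K * Real.exp (-(s / 2)) with hv
  have hgauss : ∫⁻ x : ℝ, ENNReal.ofReal (φ x) = ENNReal.ofReal (Real.sqrt (2 * Real.pi)) := by
    rw [← ofReal_integral_eq_lintegral_ofReal (integrable_exp_neg_mul_sq (by norm_num))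
      (Filter.Eventually.of_forall fun x => (Real.exp_pos _).le), integral_gaussian]
    congr 2
    ring
  have hprod : ∀ s : ℝ, Real.exp (s / 2) * Real.exp (-(s / 2)) = 1 := fun s => by
    rw [← Real.exp_add]; simp
  have hA : ∀ s : ℝ, Real.exp (s / 2 + K - K ^ 2 / (2 * Real.exp s) - Real.exp s / 2)
      = Real.exp (s / 2) * φ (v s) := by
    intro s
    simp only [hφ, hv]
    rw [← Real.exp_add]
    congr 1
    have h2 : Real.exp s = Real.exp (s / 2) ^ 2 := by
      rw [← Real.exp_nat_mul]; congr 1; push_cast; ring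
    rw [h2, Real.exp_neg]
    have := Real.exp_pos (s / 2)
    field_simp
    ring
  have hderiv : ∀ s : ℝ, HasDerivAt v ((Real.exp (s / 2) + K * Real.exp (-(s / 2))) / 2) s := by
    intro s
    have h1 : HasDerivAt (fun s : ℝ => s / 2) (1 / 2) s := (hasDerivAt_id s).div_const 2
    have h2 : HasDerivAt (fun s : ℝ => -(s / 2)) (-(1 / 2)) s := h1.neg
    have h3 : HasDerivAt v (Real.exp (s / 2) * (1 / 2) - K * (Real.exp (-(s / 2)) * (-(1 / 2)))) s :=
      h1.exp.sub ((h2.exp).const_mul K)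
    exact h3.congr_deriv (by ring)
  have hmono : StrictMono v := by
    apply strictMono_of_hasDerivAt_pos hderiv
    intro s
    positivity
  have hsurj : Function.Surjective v := by
    intro y
    have hlt : |y| < Real.sqrt (y ^ 2 + 4 * K) := by
      rw [← Real.sqrt_sq_eq_abs]
      exact Real.sqrt_lt_sqrt (sq_nonneg _) (by linarith)
    have hz : 0 < (y + Real.sqrt (y ^ 2 + 4 * K)) / 2 := by
      have := neg_abs_le y
      linarith
    have hsq := Real.sq_sqrt (show 0 ≤ y ^ 2 + 4 * K by positivity)
    refine ⟨2 * Real.log ((y + Real.sqrt (y ^ 2 + 4 * K)) / 2), ?_⟩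
    simp only [hv]
    rw [mul_div_cancel_left₀ _ (two_ne_zero), Real.exp_neg, Real.exp_log hz]
    set r := Real.sqrt (y ^ 2 + 4 * K)
    have hz' : y + r ≠ 0 := by intro h; rw [h] at hz; simp at hz
    field_simp
    nlinarith
  have hcv : ∫⁻ s : ℝ, ENNReal.ofReal ((Real.exp (s / 2) + K * Real.exp (-(s / 2))) / 2)
      * ENNReal.ofReal (φ (v s)) = ENNReal.ofReal (Real.sqrt (2 * Real.pi)) := by
    have := lintegral_image_eq_lintegral_abs_deriv_mul (s := Set.univ) (f := v)
      (f' := fun s => (Real.exp (s / 2) + K * Real.exp (-(s / 2))) / 2) MeasurableSet.univ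
      (fun x _ => (hderiv x).hasDerivWithinAt) hmono.injective.injOn
      (fun x => ENNReal.ofReal (φ x))
    rw [Set.image_univ, hsurj.range_eq, Measure.restrict_univ, hgauss] at this
    rw [this]
    apply lintegral_congr
    intro s
    rw [abs_of_pos (by positivity)]
  have hsymm : ∫⁻ s : ℝ, ENNReal.ofReal (Real.exp (s / 2) * φ (v s))
      = ∫⁻ s : ℝ, ENNReal.ofReal (K * Real.exp (-(s / 2)) * φ (v s)) := by
    rw [← lintegral_sub_left_eq_self _ (2 * Real.log K)]
    apply lintegral_congr
    intro s
    have e1 : Real.exp ((2 * Real.log K - s) / 2) = K * Real.exp (-(s / 2)) := by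
      rw [show (2 * Real.log K - s) / 2 = Real.log K + -(s / 2) by ring, Real.exp_add,
        Real.exp_log hK]
    have e2 : K * Real.exp (-((2 * Real.log K - s) / 2)) = Real.exp (s / 2) := by
      rw [show -((2 * Real.log K - s) / 2) = -Real.log K + (s / 2) by ring, Real.exp_add,
        Real.exp_neg, Real.exp_log hK]
      field_simp
    have e3 : φ (v (2 * Real.log K - s)) = φ (v s) := by
      simp only [hφ, hv]
      rw [e1, e2]
      congr 1
      ring
    rw [e1, e3]
  have hm1 : Measurable fun s : ℝ => ENNReal.ofReal (Real.exp (s / 2) * φ (v s)) := by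
    simp only [hφ, hv]
    fun_prop
  have hadd : (∫⁻ s : ℝ, ENNReal.ofReal (Real.exp (s / 2) * φ (v s)))
      + (∫⁻ s : ℝ, ENNReal.ofReal (Real.exp (s / 2) * φ (v s)))
      = 2 * ENNReal.ofReal (Real.sqrt (2 * Real.pi)) := by
    nth_rewrite 2 [hsymm]
    rw [← lintegral_add_left hm1, ← hcv, ← lintegral_const_mul']
    · apply lintegral_congr
      intro s
      have hp : 0 < φ (v s) := Real.exp_pos _
      rw [← ENNReal.ofReal_mul (by positivity), ← ENNReal.ofReal_add (by positivity) (by positivity),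
        show (2 : ENNReal) = ENNReal.ofReal 2 by simp, ← ENNReal.ofReal_mul (by norm_num)]
      congr 1
      ring
    · simp
  simp_rw [hA]
  rw [← two_mul] at hadd
  exact (ENNReal.mul_right_inj (by norm_num) (by norm_num)).1 hadd

/-- reduced weights -/
def Wred {n : ℕ} (W : Fin (n + 1) → Fin (n + 1) → ℝ) (s : ℝ) : Fin n → Fin n → ℝ :=
  fun i j => if i = j then 0 else
    W i.succ j.succ + W 0 i.succ * W 0 j.succ * Real.exp (-s)

/-- reduced pinning -/
def Ered {n : ℕ} (W : Fin (n + 1) → Fin (n + 1) → ℝ) (ε : Fin (n + 1) → ℝ) (s : ℝ) :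
    Fin n → ℝ :=
  fun i => ε i.succ + W 0 i.succ * ε 0 * Real.exp (-s)

/-- local field -/
def cfun {n : ℕ} (W : Fin (n + 1) → Fin (n + 1) → ℝ) (ε : Fin (n + 1) → ℝ) (t : Fin n → ℝ) : ℝ :=
  (∑ i, W 0 i.succ * Real.exp (t i)) + ε 0

lemma cfun_pos {n : ℕ} (W : Fin (n + 1) → Fin (n + 1) → ℝ) (hW : ∀ i j, 0 ≤ W i j)
    (ε : Fin (n + 1) → ℝ) (hε : ∀ k, 0 < ε k) (t : Fin n → ℝ) : 0 < cfun W ε t := by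
  have : 0 ≤ ∑ i, W 0 i.succ * Real.exp (t i) :=
    Finset.sum_nonneg fun i _ => mul_nonneg (hW _ _) (Real.exp_pos _).le
  have := hε 0
  unfold cfun
  linarith

lemma det_red {n : ℕ} (W : Fin (n + 1) → Fin (n + 1) → ℝ) (hsym : ∀ i j, W i j = W j i)
    (hW : ∀ i j, 0 ≤ W i j) (hd : ∀ i, W i i = 0)
    (ε : Fin (n + 1) → ℝ) (hε : ∀ k, 0 < ε k) (s : ℝ) (t : Fin n → ℝ) :
    (Dmat0 W ε (Fin.cons (Real.log (cfun W ε t) - s) t)).det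
      = Real.exp (2 * (Real.log (cfun W ε t) - s) + s) * (Dmat0 (Wred W s) (Ered W ε s) t).det := by
  have hc := cfun_pos W hW ε hε t
  set c := cfun W ε t with hcdef
  set t0 := Real.log c - s with ht0
  have het0 : Real.exp t0 = c * Real.exp (-s) := by
    rw [ht0, sub_eq_add_neg, Real.exp_add, Real.exp_log hc]
  set B := Dmat0 W ε (Fin.cons t0 t) with hB
  have hB00 : B 0 0 = Real.exp t0 * c := by
    simp only [hB, Dmat0, Matrix.of_apply, if_true, Fin.sum_univ_succ, Fin.cons_zero, Fin.cons_succ,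
      hd, hcdef, cfun, Real.exp_add, mul_add, Finset.mul_sum]
    rw [zero_mul, zero_add, mul_comm (ε 0)]
    congr 1
    apply Finset.sum_congr rfl
    intro i _
    rw [hsym i.succ 0]; ring
  have hB0 : ∀ j : Fin n, B 0 j.succ = -(W 0 j.succ * Real.exp (t0 + t j)) := by
    intro j
    simp [hB, Dmat0, (Fin.succ_ne_zero j).symm]
  have hB1 : ∀ j : Fin n, B j.succ 0 = -(W 0 j.succ * Real.exp (t0 + t j)) := by
    intro j
    simp [hB, Dmat0, hsym j.succ 0, add_comm]
  set q : Fin (n + 1) → ℝ := Fin.cons 0 (fun i => W 0 i.succ * Real.exp (t i) / c) with hq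
  set A : Matrix (Fin (n + 1)) (Fin (n + 1)) ℝ := Matrix.of fun i j => B i j + q i * B 0 j with hA
  have hdet : A.det = B.det :=
    Matrix.det_eq_of_forall_row_eq_smul_add_const q 0 (by simp [hq]) (fun i j => by simp [hA])
  rw [← hdet, Matrix.det_succ_column_zero, Fin.sum_univ_succ]
  have hA0 : ∀ i : Fin n, A i.succ 0 = 0 := by
    intro i
    simp only [hA, hq, Matrix.of_apply, Fin.cons_succ, hB1, hB00, Real.exp_add]
    field_simp
    ring
  have hsub : A.submatrix Fin.succ Fin.succ = Dmat0 (Wred W s) (Ered W ε s) t := by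
    ext i j
    simp only [Matrix.submatrix_apply, hA, Matrix.of_apply, hq, Fin.cons_succ, hB0]
    by_cases hij : i = j
    · subst hij
      have key : ∑ k, Wred W s k i * Real.exp (t k + t i)
          = (∑ k : Fin n, W k.succ i.succ * Real.exp (t k + t i))
            + (W 0 i.succ * Real.exp (t i) * Real.exp (-s)) * (c - ε 0)
            - W 0 i.succ * W 0 i.succ * Real.exp (-s) * Real.exp (t i + t i) := by
        have : ∀ k, Wred W s k i * Real.exp (t k + t i) = 
            W k.succ i.succ * Real.exp (t k + t i)
             + (W 0 i.succ * Real.exp (t i) * Real.exp (-s)) * (W 0 k.succ * Real.exp (t k))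
             - (if k = i then W 0 i.succ * W 0 i.succ * Real.exp (-s) * Real.exp (t i + t i) else 0) := by
          intro k
          by_cases hk : k = i
          · subst hk
            simp [Wred, hd, Real.exp_add]; ring
          · simp [Wred, hk, Real.exp_add]; ring
        rw [Finset.sum_congr rfl (fun k _ => this k), Finset.sum_sub_distrib, Finset.sum_add_distrib,
          ← Finset.mul_sum]
        simp [hcdef, cfun]
      simp only [hB, Dmat0, Matrix.of_apply, if_true, Fin.sum_univ_succ, Fin.cons_zero,
        Fin.cons_succ, key, Ered]
      simp only [Real.exp_add, het0]
      field_simp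
      ring
    · have hij' : i.succ ≠ j.succ := fun h => hij (Fin.succ_injective _ h)
      simp only [hB, Dmat0, Matrix.of_apply, hij, hij', if_false, Fin.cons_succ, Wred,
        Real.exp_add, het0]
      field_simp
      ring
  have hA00 : A 0 0 = Real.exp (2 * t0 + s) := by
    simp only [hA, hq, Matrix.of_apply, Fin.cons_zero, hB00]
    rw [show 2 * t0 + s = t0 + Real.log c by rw [ht0]; ring, Real.exp_add, Real.exp_log hc]
    ring
  simp [hA0, hsub, hA00]

lemma Wred_props {n : ℕ} (W : Fin (n + 1) → Fin (n + 1) → ℝ) (hsym : ∀ i j, W i j = W j i)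
    (hW : ∀ i j, 0 ≤ W i j)
    (ε : Fin (n + 1) → ℝ) (hε : ∀ k, 0 < ε k) (s : ℝ) :
    (∀ i j, Wred W s i j = Wred W s j i) ∧ (∀ i j, 0 ≤ Wred W s i j) ∧ (∀ i, Wred W s i i = 0)
      ∧ (∀ k, 0 < Ered W ε s k) := by
  refine ⟨fun i j => ?_, fun i j => ?_, fun i => by simp [Wred], fun k => ?_⟩
  · unfold Wred
    by_cases h : i = j
    · simp [h]
    · simp only [h, Ne.symm h, if_false, hsym i.succ j.succ]
      ring
  · unfold Wred
    split_ifs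
    · exact le_rfl
    · exact add_nonneg (hW _ _) (mul_nonneg (mul_nonneg (hW _ _) (hW _ _)) (Real.exp_pos _).le)
  · exact add_pos_of_pos_of_nonneg (hε _)
      (mul_nonneg (mul_nonneg (hW _ _) (hε _).le) (Real.exp_pos _).le)

lemma det_pos : ∀ (n : ℕ) (W : Fin n → Fin n → ℝ) (_ : ∀ i j, W i j = W j i)
    (_ : ∀ i j, 0 ≤ W i j) (_ : ∀ i, W i i = 0)
    (ε : Fin n → ℝ) (_ : ∀ k, 0 < ε k) (t : Fin n → ℝ), 0 < (Dmat0 W ε t).det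
  | 0, W, _, _, _, ε, _, t => by simp
  | n + 1, W, hsym, hW, hd, ε, hε, t => by
    obtain ⟨h1, h2, h3, h4⟩ := Wred_props W hsym hW ε hε
      (Real.log (cfun W ε (Fin.tail t)) - t 0)
    have := det_red W hsym hW hd ε hε (Real.log (cfun W ε (Fin.tail t)) - t 0) (Fin.tail t)
    rw [sub_sub_cancel, Fin.cons_self_tail] at this
    rw [this]
    exact mul_pos (Real.exp_pos _) (det_pos n _ h1 h2 h3 _ h4 _)

lemma F0_red {n : ℕ} (W : Fin (n + 1) → Fin (n + 1) → ℝ) (hsym : ∀ i j, W i j = W j i)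
    (hW : ∀ i j, 0 ≤ W i j) (hd : ∀ i, W i i = 0)
    (ε : Fin (n + 1) → ℝ) (hε : ∀ k, 0 < ε k) (s : ℝ) (t : Fin n → ℝ) :
    -(F0 W ε (Fin.cons (Real.log (cfun W ε t) - s) t))
      = (s / 2 + cfun W ε 0 - (cfun W ε 0) ^ 2 / (2 * Real.exp s) - Real.exp s / 2)
        + -(F0 (Wred W s) (Ered W ε s) t) := by
  have hc := cfun_pos W hW ε hε t
  obtain ⟨h1, h2, h3, h4⟩ := Wred_props W hsym hW ε hε s
  have hdet := det_pos n _ h1 h2 h3 _ h4 t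
  unfold F0
  rw [det_red W hsym hW hd ε hε, Real.log_mul (Real.exp_pos _).ne' hdet.ne', Real.log_exp]
  set L := Real.log (Dmat0 (Wred W s) (Ered W ε s) t).det
  set t0 := Real.log (cfun W ε t) - s with ht0
  have het0 : Real.exp t0 = cfun W ε t * Real.exp (-s) := by
    rw [ht0, sub_eq_add_neg, Real.exp_add, Real.exp_log hc]
  have het0' : Real.exp (-t0) = Real.exp s / cfun W ε t := by
    rw [ht0, neg_sub, Real.exp_sub, Real.exp_log hc]
  set Q := ∑ i, W 0 i.succ * Real.exp (t i) with hQ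
  set P := ∑ i, W 0 i.succ * Real.exp (-t i) with hP
  set σ := ∑ i : Fin n, W 0 i.succ with hσ
  have hcQ : cfun W ε t = Q + ε 0 := rfl
  have hc0 : cfun W ε 0 = σ + ε 0 := by simp [cfun, hσ]
  -- pair terms with vertex 0
  have hpair : ∑ j : Fin n, W 0 j.succ * (Real.cosh (t0 - t j) - 1)
      = (Real.exp t0 * P + Real.exp (-t0) * Q) / 2 - σ := by
    have : ∀ j, W 0 j.succ * (Real.cosh (t0 - t j) - 1)
        = (Real.exp t0 / 2) * (W 0 j.succ * Real.exp (-t j))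
          + (Real.exp (-t0) / 2) * (W 0 j.succ * Real.exp (t j)) - W 0 j.succ := by
      intro j
      rw [Real.cosh_eq, neg_sub, sub_eq_add_neg t0, sub_eq_add_neg (t j), Real.exp_add, Real.exp_add]
      ring
    rw [Finset.sum_congr rfl (fun k _ => this k), Finset.sum_sub_distrib, Finset.sum_add_distrib,
      ← Finset.mul_sum, ← Finset.mul_sum]
    ring
  have hpair' : ∑ j : Fin n, W j.succ 0 * (Real.cosh (t j - t0) - 1)
      = (Real.exp t0 * P + Real.exp (-t0) * Q) / 2 - σ := by
    rw [← hpair]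
    apply Finset.sum_congr rfl
    intro j _
    rw [hsym, ← Real.cosh_neg, neg_sub]
  have hfull : ∑ i : Fin (n + 1), ∑ j : Fin (n + 1), W i j *
        (Real.cosh ((Fin.cons t0 t : Fin (n + 1) → ℝ) i - (Fin.cons t0 t : Fin (n + 1) → ℝ) j) - 1)
      = 2 * ((Real.exp t0 * P + Real.exp (-t0) * Q) / 2 - σ)
        + ∑ i : Fin n, ∑ j : Fin n, W i.succ j.succ * (Real.cosh (t i - t j) - 1) := by
    simp only [Fin.sum_univ_succ, Fin.cons_zero, Fin.cons_succ, Finset.sum_add_distrib, hpair,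
      hpair', hd]
    ring
  have hred : ∑ i : Fin n, ∑ j : Fin n, Wred W s i j * (Real.cosh (t i - t j) - 1)
      = (∑ i : Fin n, ∑ j : Fin n, W i.succ j.succ * (Real.cosh (t i - t j) - 1))
        + Real.exp (-s) * (Q * P - σ ^ 2) := by
    have : ∀ i j, Wred W s i j * (Real.cosh (t i - t j) - 1)
        = W i.succ j.succ * (Real.cosh (t i - t j) - 1)
          + ((Real.exp (-s) / 2) * ((W 0 i.succ * Real.exp (t i)) * (W 0 j.succ * Real.exp (-t j)))
            + (Real.exp (-s) / 2) * ((W 0 i.succ * Real.exp (-t i)) * (W 0 j.succ * Real.exp (t j)))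
            - Real.exp (-s) * (W 0 i.succ * W 0 j.succ)) := by
      intro i j
      have hk : Wred W s i j * (Real.cosh (t i - t j) - 1)
        = (W i.succ j.succ + W 0 i.succ * W 0 j.succ * Real.exp (-s)) * (Real.cosh (t i - t j) - 1) := by
        by_cases h : i = j
        · simp [h]
        · simp [Wred, h]
      rw [hk, Real.cosh_eq, neg_sub, sub_eq_add_neg (t i), sub_eq_add_neg (t j), Real.exp_add,
        Real.exp_add]
      ring
    simp only [this, Finset.sum_add_distrib, Finset.sum_sub_distrib, ← Finset.mul_sum,
      ← Finset.sum_mul]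
    rw [← hQ, ← hP, ← hσ]
    ring
  have hfield : ∑ k : Fin n, (t k - Ered W ε s k + Ered W ε s k * Real.cosh (t k))
      = (∑ k : Fin n, (t k - ε k.succ + ε k.succ * Real.cosh (t k)))
        + Real.exp (-s) * ε 0 * ((Q + P) / 2 - σ) := by
    have : ∀ k, (t k - Ered W ε s k + Ered W ε s k * Real.cosh (t k))
        = (t k - ε k.succ + ε k.succ * Real.cosh (t k))
          + ((Real.exp (-s) * ε 0 / 2) * (W 0 k.succ * Real.exp (t k))
            + (Real.exp (-s) * ε 0 / 2) * (W 0 k.succ * Real.exp (-t k))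
            - (Real.exp (-s) * ε 0) * W 0 k.succ) := by
      intro k
      rw [Ered, Real.cosh_eq]
      ring
    simp only [this, Finset.sum_add_distrib, Finset.sum_sub_distrib, ← Finset.mul_sum]
    rw [← hQ, ← hP, ← hσ]
    ring
  rw [hfull, hred, hfield, Fin.sum_univ_succ]
  simp only [Fin.cons_zero, Fin.cons_succ]
  rw [Real.cosh_eq t0, het0, het0', hc0, hcQ, Real.exp_neg]
  have hne : Q + ε 0 ≠ 0 := by rw [← hcQ]; exact hc.ne'
  have := Real.exp_pos s
  field_simp
  ring

lemma measurable_F0 {n : ℕ} (W : ℝ → Fin n → Fin n → ℝ) (ε : ℝ → Fin n → ℝ)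
    (hW : ∀ i j, Continuous fun s => W s i j) (hε : ∀ i, Continuous fun s => ε s i) :
    Measurable fun p : (Fin n → ℝ) × ℝ => F0 (W p.2) (ε p.2) p.1 := by
  unfold F0
  have hdet : Continuous fun p : (Fin n → ℝ) × ℝ => (Dmat0 (W p.2) (ε p.2) p.1).det := by
    apply Continuous.matrix_det
    apply continuous_matrix
    intro i j
    unfold Dmat0
    simp only [Matrix.of_apply]
    split_ifs
    · fun_prop
    · fun_prop
  have h1 : Continuous fun p : (Fin n → ℝ) × ℝ =>
      (1 / 2) * (∑ i, ∑ j, W p.2 i j * (Real.cosh (p.1 i - p.1 j) - 1)) := by fun_prop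
  have h2 : Continuous fun p : (Fin n → ℝ) × ℝ =>
      ∑ k, (p.1 k - ε p.2 k + ε p.2 k * Real.cosh (p.1 k)) := by fun_prop
  exact (h1.measurable.sub ((Real.measurable_log.comp hdet.measurable).const_mul _)).add
    h2.measurable

lemma main_fin : ∀ (n : ℕ) (W : Fin n → Fin n → ℝ) (_ : ∀ i j, W i j = W j i)
    (_ : ∀ i j, 0 ≤ W i j) (_ : ∀ i, W i i = 0)
    (ε : Fin n → ℝ) (_ : ∀ k, 0 < ε k),
    ∫⁻ t : Fin n → ℝ, ENNReal.ofReal (Real.exp (-(F0 W ε t)))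
      = ENNReal.ofReal (Real.sqrt (2 * Real.pi)) ^ n
  | 0, W, _, _, _, ε, _ => by
    simp [F0, volume_pi]
  | n + 1, W, hsym, hW, hd, ε, hε => by
    have hmeas : Measurable fun t : Fin (n + 1) → ℝ => ENNReal.ofReal (Real.exp (-(F0 W ε t))) := by
      have := (measurable_F0 (fun _ => W) (fun _ => ε) (fun _ _ => continuous_const)
        (fun _ => continuous_const)).comp
        (show Measurable fun t : Fin (n + 1) → ℝ => (t, (0 : ℝ)) by fun_prop)
      exact (Real.measurable_exp.comp this.neg).ennreal_ofReal
    have hmp := (volume_preserving_piFinSuccAbove (fun _ : Fin (n + 1) => ℝ) 0).symm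
    rw [← hmp.lintegral_comp hmeas]
    have hrw : ∀ p : ℝ × (Fin n → ℝ),
        (MeasurableEquiv.piFinSuccAbove (fun _ : Fin (n + 1) => ℝ) 0).symm p
          = Fin.cons p.1 p.2 := by
      intro p
      simp [MeasurableEquiv.piFinSuccAbove, Fin.insertNthEquiv]
    have hmeas2 := hmeas.comp hmp.measurable
    simp only [Function.comp_def, hrw] at hmeas2
    simp only [hrw]
    rw [Measure.volume_eq_prod, lintegral_prod_symm _ hmeas2.aemeasurable]
    have hstep : ∀ t : Fin n → ℝ,
        ∫⁻ x : ℝ, ENNReal.ofReal (Real.exp (-(F0 W ε (Fin.cons x t))))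
        = ∫⁻ s : ℝ, ENNReal.ofReal (Real.exp
            (s / 2 + cfun W ε 0 - (cfun W ε 0) ^ 2 / (2 * Real.exp s) - Real.exp s / 2))
          * ENNReal.ofReal (Real.exp (-(F0 (Wred W s) (Ered W ε s) t))) := by
      intro t
      rw [← lintegral_sub_left_eq_self _ (Real.log (cfun W ε t))]
      apply lintegral_congr
      intro s
      rw [F0_red W hsym hW hd ε hε, Real.exp_add, ENNReal.ofReal_mul (Real.exp_pos _).le]
    simp only [hstep]
    have hmF : Measurable fun p : (Fin n → ℝ) × ℝ => F0 (Wred W p.2) (Ered W ε p.2) p.1 := by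
      apply measurable_F0
      · intro i j
        unfold Wred
        split_ifs <;> fun_prop
      · intro i
        unfold Ered
        fun_prop
    rw [lintegral_lintegral_swap]
    · have hin : ∀ s : ℝ, ∫⁻ t : Fin n → ℝ, ENNReal.ofReal (Real.exp
            (s / 2 + cfun W ε 0 - (cfun W ε 0) ^ 2 / (2 * Real.exp s) - Real.exp s / 2))
          * ENNReal.ofReal (Real.exp (-(F0 (Wred W s) (Ered W ε s) t)))
          = ENNReal.ofReal (Real.exp
            (s / 2 + cfun W ε 0 - (cfun W ε 0) ^ 2 / (2 * Real.exp s) - Real.exp s / 2))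
            * ENNReal.ofReal (Real.sqrt (2 * Real.pi)) ^ n := by
        intro s
        obtain ⟨h1, h2, h3, h4⟩ := Wred_props W hsym hW ε hε s
        rw [lintegral_const_mul' _ _ ENNReal.ofReal_ne_top, main_fin n _ h1 h2 h3 _ h4]
      simp only [hin]
      rw [lintegral_mul_const' _ _ (ENNReal.pow_ne_top ENNReal.ofReal_ne_top),
        one_dim _ (cfun_pos W hW ε hε 0), pow_succ, mul_comm]
    · apply Measurable.aemeasurable
      refine Measurable.mul (f := fun p : (Fin n → ℝ) × ℝ => ENNReal.ofReal (Real.exp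
            (p.2 / 2 + cfun W ε 0 - (cfun W ε 0) ^ 2 / (2 * Real.exp p.2) - Real.exp p.2 / 2)))
        (g := fun p => ENNReal.ofReal (Real.exp (-(F0 (Wred W p.2) (Ered W ε p.2) p.1)))) ?_ ?_
      · fun_prop
      · exact (Real.measurable_exp.comp hmF.neg).ennreal_ofReal

lemma F0_equiv {V U : Type*} [Fintype V] [DecidableEq V] [Fintype U] [DecidableEq U] (e : U ≃ V)
    (W : V → V → ℝ) (ε : V → ℝ) (t : V → ℝ) :
    F0 (fun i j => W (e i) (e j)) (fun i => ε (e i)) (fun i => t (e i)) = F0 W ε t := by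
  have hD : Dmat0 (fun i j => W (e i) (e j)) (fun i => ε (e i)) (fun i => t (e i))
      = (Dmat0 W ε t).submatrix e e := by
    ext i j
    simp only [Dmat0, Matrix.of_apply, Matrix.submatrix_apply, e.injective.eq_iff]
    by_cases h : i = j
    · subst h; simp [e.sum_comp (fun x => W x (e i) * Real.exp (t x + t (e i)))]
    · simp [h]
  unfold F0
  rw [hD, Matrix.det_submatrix_equiv_self,
    ← e.sum_comp (fun k => t k - ε k + ε k * Real.cosh (t k)),
    ← e.sum_comp (fun i => ∑ j, W i j * (Real.cosh (t i - t j) - 1))]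
  congr 4
  funext i
  rw [← e.sum_comp (fun j => W (e i) j * (Real.cosh (t (e i) - t j) - 1))]

/-- **The partition function of the reduced `H^{2|2}` model equals one.** -/
theorem partition_function_eq_one
    {V : Type*} [Fintype V] [DecidableEq V] [Nonempty V]
    (W : V → V → ℝ) (hWsym : ∀ i j, W i j = W j i) (hWnonneg : ∀ i j, 0 ≤ W i j)
    (hWdiag : ∀ i, W i i = 0)
    (ε : V → ℝ) (hε : ∀ k, 0 < ε k) :
    (∫ t : V → ℝ,
        Real.exp (-(F0 W ε t)) * ((Real.sqrt (2 * Real.pi))⁻¹) ^ (Fintype.card V)) = 1 := by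
  set n := Fintype.card V with hn
  set e : Fin n ≃ V := (Fintype.equivFin V).symm
  set W' : Fin n → Fin n → ℝ := fun i j => W (e i) (e j)
  set ε' : Fin n → ℝ := fun i => ε (e i)
  have hmain := main_fin n W' (fun i j => hWsym _ _) (fun i j => hWnonneg _ _)
    (fun i => hWdiag _) ε' (fun k => hε _)
  have hmp := (volume_measurePreserving_piCongrLeft (fun _ : Fin n => ℝ) e.symm)
  have hcongr : ∀ t : V → ℝ, F0 W ε t
      = F0 W' ε' (MeasurableEquiv.piCongrLeft (fun _ : Fin n => ℝ) e.symm t) := by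
    intro t
    rw [← F0_equiv e]
    congr 1
    funext i
    have := MeasurableEquiv.piCongrLeft_apply_apply (β := fun _ : Fin n => ℝ) e.symm t (e i)
    rw [Equiv.symm_apply_apply] at this
    exact this.symm
  have hpos : 0 < Real.sqrt (2 * Real.pi) := by positivity
  rw [integral_mul_const]
  have hint : ∫ t : V → ℝ, Real.exp (-(F0 W ε t)) = Real.sqrt (2 * Real.pi) ^ n := by
    simp only [hcongr]
    rw [hmp.integral_comp' (g := fun t => Real.exp (-(F0 W' ε' t))),
      integral_eq_lintegral_of_nonneg_ae
        (Filter.Eventually.of_forall fun t => (Real.exp_pos _).le), hmain, ENNReal.toReal_pow,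
      ENNReal.toReal_ofReal hpos.le]
    have := (measurable_F0 (fun _ => W') (fun _ => ε') (fun _ _ => continuous_const)
        (fun _ => continuous_const)).comp
        (show Measurable fun t : Fin n → ℝ => (t, (0 : ℝ)) by fun_prop)
    exact (Real.measurable_exp.comp this.neg).aestronglyMeasurable
  rw [hint, ← mul_pow, mul_inv_cancel₀ hpos.ne', one_pow]

end
end

section
/- Sum rule (Ward identity of the hyperbolic symmetry): for every β > 0, every ε > 0, every L ≥ 2 and every site x ∈ Λ, Σ_{y∈Λ} ⟨e^{t_x+t_y} (D_{β,ε}(t)^{-1})_{xy}⟩ = 1/ε. -/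
open scoped BigOperators Classical
open MeasureTheory

noncomputable section

/-- The 3-dimensional discrete torus of side `L`. -/
abbrev Torus (L : ℕ) := Fin 3 → ZMod L

/-- The unit vector in direction `i`. -/
def unitVec (L : ℕ) (i : Fin 3) : Torus L := fun j => if j = i then 1 else 0

/-- Nearest-neighbor relation on the torus. -/
def NN {L : ℕ} (x y : Torus L) : Prop :=
  x ≠ y ∧ ∃ i : Fin 3, y = x + unitVec L i ∨ y = x - unitVec L i

/-- Periodic (Euclidean) distance on the torus. -/
def torusDist {L : ℕ} (x y : Torus L) : ℝ :=
  Real.sqrt (∑ i : Fin 3, (min ((x i - y i).val) (L - (x i - y i).val) : ℝ) ^ 2)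

variable {L : ℕ}

/-- Sum of a (symmetric) function over unordered nearest-neighbor pairs. -/
def nnSum [NeZero L] (f : Torus L → Torus L → ℝ) : ℝ :=
  (1 / 2) * ∑ x : Torus L, ∑ y : Torus L, if NN x y then f x y else 0

/-- The matrix of the operator `D_{β,ε}(t)`, the symmetric operator on `ℝ^Λ` with
quadratic form `β ∑_{NN (ij)} e^{t_i+t_j}(v_i-v_j)² + ε ∑_k e^{t_k} v_k²`. -/
def Dmat [NeZero L] (β ε : ℝ) (t : Torus L → ℝ) : Matrix (Torus L) (Torus L) ℝ :=
  Matrix.of fun j k =>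
    if j = k then
      β * (∑ i : Torus L, if NN i j then Real.exp (t i + t j) else 0) + ε * Real.exp (t j)
    else if NN j k then -(β * Real.exp (t j + t k)) else 0

/-- The free energy (effective action) `F_{β,ε}(t)`. -/
def freeEnergy [NeZero L] (β ε : ℝ) (t : Torus L → ℝ) : ℝ :=
  β * nnSum (fun i j => Real.cosh (t i - t j) - 1)
    - (1 / 2) * Real.log (Dmat β ε t).det
    + ∑ k : Torus L, (t k - ε + ε * Real.cosh (t k))

/-- The expectation `⟨f⟩ = ∫ f(t) e^{-F_{β,ε}(t)} ∏ dt_k/√(2π)`. -/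
def expect [NeZero L] (β ε : ℝ) (f : (Torus L → ℝ) → ℝ) : ℝ :=
  ∫ t : Torus L → ℝ,
    f t * Real.exp (-(freeEnergy β ε t)) *
      ((Real.sqrt (2 * Real.pi))⁻¹) ^ (Fintype.card (Torus L))


theorem oneD_aux (a : ℝ) (ha : 0 < a) :
    (∫⁻ τ : ℝ, ENNReal.ofReal (√a * Real.exp (τ/2) * Real.exp (-(a * Real.cosh τ))))
      = ENNReal.ofReal (√(2*Real.pi) * Real.exp (-a)) := by
  set J1 := ∫⁻ τ : ℝ, ENNReal.ofReal (√a * Real.exp (τ/2) * Real.exp (-(a * Real.cosh τ))) with hJ1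
  have hneg : J1 = ∫⁻ τ : ℝ, ENNReal.ofReal (√a * Real.exp (-(τ/2)) * Real.exp (-(a * Real.cosh τ))) := by
    rw [hJ1, ← lintegral_neg_eq_self]
    refine lintegral_congr fun τ => ?_
    rw [Real.cosh_neg, neg_div]
  have hsum : J1 + J1 = 2 * ENNReal.ofReal (√(2*Real.pi) * Real.exp (-a)) := by
    nth_rw 2 [hneg]
    rw [hJ1, ← lintegral_add_left (by fun_prop)]
    have himg : (fun τ : ℝ => 2 * √a * Real.sinh (τ/2)) '' Set.univ = Set.univ := by
      rw [Set.image_univ]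
      refine Set.range_eq_univ.2 fun y => ⟨2 * Real.arsinh (y / (2*√a)), ?_⟩
      have : √a ≠ 0 := (Real.sqrt_pos.2 ha).ne'
      simp only [mul_div_cancel_left₀ _ (two_ne_zero' ℝ), Real.sinh_arsinh]
      field_simp
    have hg : (∫⁻ u : ℝ, ENNReal.ofReal (Real.exp (-(1/2) * u^2))) = ENNReal.ofReal (√(2*Real.pi)) := by
      rw [← ofReal_integral_eq_lintegral_ofReal (integrable_exp_neg_mul_sq (by norm_num))
        (Filter.Eventually.of_forall fun _ => (Real.exp_pos _).le), integral_gaussian]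
      congr 2; ring
    have hcv := lintegral_image_eq_lintegral_abs_deriv_mul (s := Set.univ)
      (f := fun τ : ℝ => 2 * √a * Real.sinh (τ/2)) (f' := fun τ => √a * Real.cosh (τ/2))
      MeasurableSet.univ (fun τ _ => by
        have := (((hasDerivAt_id τ).div_const 2).sinh.const_mul (2 * √a)).hasDerivWithinAt (s := Set.univ)
        refine HasDerivWithinAt.congr_deriv this ?_
        simp only [id]; ring) (by
        intro x _ y _ h
        have : 2 * √a ≠ 0 := by positivity
        have h2 := Real.sinh_injective (mul_left_cancel₀ this h)
        linarith) (fun u => ENNReal.ofReal (Real.exp (-(1/2) * u^2)))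
    rw [himg, Measure.restrict_univ, hg] at hcv
    rw [ENNReal.ofReal_mul (by positivity), hcv, mul_comm (lintegral _ _), ← mul_assoc,
      ← lintegral_const_mul _ (by fun_prop)]
    refine lintegral_congr fun τ => ?_
    rw [← ENNReal.ofReal_add (by positivity) (by positivity), show (2:ENNReal) = ENNReal.ofReal 2 by simp,
      ← ENNReal.ofReal_mul (by positivity),
      ← ENNReal.ofReal_mul (by positivity), ← ENNReal.ofReal_mul (by positivity)]
    congr 1
    rw [abs_of_pos (mul_pos (Real.sqrt_pos.2 ha) (Real.cosh_pos _))]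
    have e1 : Real.cosh τ = 1 + 2 * Real.sinh (τ/2)^2 := by
      have := Real.cosh_two_mul (τ/2)
      have h2 := Real.cosh_sq (τ/2)
      rw [show 2 * (τ/2) = τ by ring] at this
      rw [this, h2]; ring
    have e2 : -(a * Real.cosh τ) = -a + -(1/2) * (2 * √a * Real.sinh (τ/2))^2 := by
      rw [e1, mul_pow, mul_pow, Real.sq_sqrt ha.le]; ring
    rw [e2, Real.exp_add, Real.cosh_eq]; ring
  rw [← two_mul] at hsum
  exact (ENNReal.mul_right_inj (by norm_num) (by norm_num)).1 hsum

theorem oneD_aux' (a : ℝ) (ha : 0 < a) :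
    (∫⁻ τ : ℝ, ENNReal.ofReal (√a * Real.exp (-(τ/2)) * Real.exp (-(a * Real.cosh τ))))
      = ENNReal.ofReal (√(2*Real.pi) * Real.exp (-a)) := by
  rw [← oneD_aux a ha]
  conv_rhs => rw [← lintegral_neg_eq_self]
  refine lintegral_congr fun τ => ?_
  rw [Real.cosh_neg, neg_div]

theorem oneD_cov (a : ℝ) (ha : 0 < a) (g : ℝ → ENNReal) :
    (∫⁻ s in Set.Ioi (0:ℝ), g s) = ∫⁻ τ : ℝ, ENNReal.ofReal (a * Real.exp τ) * g (a * Real.exp τ) := by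
  have himg : (fun τ : ℝ => a * Real.exp τ) '' Set.univ = Set.Ioi 0 := by
    ext y
    simp only [Set.image_univ, Set.mem_range, Set.mem_Ioi]
    constructor
    · rintro ⟨t, rfl⟩; positivity
    · intro hy
      exact ⟨Real.log (y/a), by rw [Real.exp_log (by positivity)]; field_simp⟩
  have hcv := lintegral_image_eq_lintegral_abs_deriv_mul (s := Set.univ)
      (f := fun τ : ℝ => a * Real.exp τ) (f' := fun τ => a * Real.exp τ)
      MeasurableSet.univ (fun τ _ => 
        ((Real.hasDerivAt_exp τ).const_mul a).hasDerivWithinAt) (by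
        intro x _ y _ h
        exact Real.exp_injective (mul_left_cancel₀ ha.ne' h)) g
  rw [himg, Measure.restrict_univ] at hcv
  rw [hcv]
  refine lintegral_congr fun τ => ?_
  rw [abs_of_pos (by positivity)]

theorem oneD (a : ℝ) (ha : 0 < a) :
    (∫⁻ s in Set.Ioi (0:ℝ), ENNReal.ofReal ((√s)⁻¹ * Real.exp (-(s + a^2/s)/2)))
      = ENNReal.ofReal (√(2*Real.pi) * Real.exp (-a)) := by
  rw [oneD_cov a ha, ← oneD_aux a ha]
  refine lintegral_congr fun τ => ?_
  rw [← ENNReal.ofReal_mul (by positivity)]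
  congr 1
  rw [Real.sqrt_mul ha.le, ← Real.exp_half, Real.cosh_eq]
  have h1 : Real.exp τ = Real.exp (τ/2) * Real.exp (τ/2) := by rw [← Real.exp_add]; ring_nf
  have h2 : a = √a * √a := (Real.mul_self_sqrt ha.le).symm
  have h3 : -(a * Real.exp τ + a^2 / (a * Real.exp τ))/2 = -(a * ((Real.exp τ + Real.exp (-τ))/2)) := by
    rw [Real.exp_neg]; field_simp
  rw [h3, ← mul_assoc]
  congr 1
  have : √a ≠ 0 := (Real.sqrt_pos.2 ha).ne'
  rw [h1]; nth_rw 1 [h2]; field_simp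

theorem oneD' (a : ℝ) (ha : 0 < a) :
    (∫⁻ s in Set.Ioi (0:ℝ), ENNReal.ofReal ((√s)⁻¹ * Real.exp (-(s + a^2/s)/2) * (a / s)))
      = ENNReal.ofReal (√(2*Real.pi) * Real.exp (-a)) := by
  rw [oneD_cov a ha, ← oneD_aux' a ha]
  refine lintegral_congr fun τ => ?_
  rw [← ENNReal.ofReal_mul (by positivity)]
  congr 1
  rw [Real.sqrt_mul ha.le, ← Real.exp_half, Real.cosh_eq]
  have h1 : Real.exp τ = Real.exp (τ/2) * Real.exp (τ/2) := by rw [← Real.exp_add]; ring_nf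
  have h2 : √a * √a = a := (Real.mul_self_sqrt ha.le)
  have h3 : -(a * Real.exp τ + a^2 / (a * Real.exp τ))/2 = -(a * ((Real.exp τ + Real.exp (-τ))/2)) := by
    rw [Real.exp_neg]; field_simp
  rw [h3]
  have h4 : a * Real.exp τ * ((√a * Real.exp (τ/2))⁻¹ * (a / (a * Real.exp τ))) = √a * Real.exp (-(τ/2)) := by
    have : √a ≠ 0 := (Real.sqrt_pos.2 ha).ne'
    rw [Real.exp_neg]; field_simp; nlinarith
  rw [← h4]; ring

section Helpers
open scoped Matrix
set_option linter.unusedSectionVars false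
variable {ι : Type} [Fintype ι] [DecidableEq ι]

/-- The matrix `diag b - W`. -/
def Mb (W : Matrix ι ι ℝ) (b : ι → ℝ) : Matrix ι ι ℝ := Matrix.diagonal b - W

/-- Density in the `b` variables. -/
def Gd (W : Matrix ι ι ℝ) (η : ι → ℝ) (b : ι → ℝ) : ℝ :=
  (√(2*Real.pi))⁻¹ ^ (Fintype.card ι) * (√(Mb W b).det)⁻¹ *
    Real.exp (-(1/2) * (∑ i, b i - ∑ i, ∑ j, W i j) - (1/2) * (η ⬝ᵥ ((Mb W b)⁻¹ *ᵥ η)) + ∑ i, η i)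

theorem continuous_Mb (W : Matrix ι ι ℝ) : Continuous (Mb W) := by
  unfold Mb; fun_prop

theorem measurable_inv_entry {α : Type} [TopologicalSpace α] [MeasurableSpace α] [BorelSpace α]
    (M : α → Matrix ι ι ℝ) (hM : Continuous M) (i j : ι) :
    Measurable (fun b => (M b)⁻¹ i j) := by
  simp only [Matrix.inv_def, Ring.inverse_eq_inv', Matrix.smul_apply, smul_eq_mul]
  have h1 : Continuous fun b => (M b).det := hM.matrix_det
  have h2 : Continuous fun b => (M b).adjugate i j := hM.matrix_adjugate.matrix_elem i j
  exact h1.measurable.inv.mul h2.measurable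

theorem measurable_invMulVec (W : Matrix ι ι ℝ) (η : ι → ℝ) (i : ι) :
    Measurable (fun b => ((Mb W b)⁻¹ *ᵥ η) i) := by
  simp only [Matrix.mulVec, dotProduct]
  exact Finset.measurable_sum _ fun j _ =>
    (measurable_inv_entry _ (continuous_Mb W) i j).mul_const _

theorem measurable_Gd (W : Matrix ι ι ℝ) (η : ι → ℝ) : Measurable (Gd W η) := by
  unfold Gd
  have h1 : Measurable fun b => (Mb W b).det := (continuous_Mb W).matrix_det.measurable
  have h2 : Measurable fun b => η ⬝ᵥ ((Mb W b)⁻¹ *ᵥ η) := by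
    simp only [dotProduct]
    exact Finset.measurable_sum _ fun j _ => (measurable_invMulVec W η j).const_mul _
  fun_prop

theorem measurableSet_posDef (W : Matrix ι ι ℝ) (hW : W.IsSymm) :
    MeasurableSet {b | (Mb W b).PosDef} := by
  have hH : ∀ b, (Mb W b).IsHermitian := fun b => by
    unfold Mb
    refine Matrix.IsHermitian.sub (Matrix.isHermitian_diagonal b) ?_
    rw [Matrix.IsHermitian, Matrix.conjTranspose_eq_transpose_of_trivial]; exact hW
  have : {b | (Mb W b).PosDef} =
      (⋂ v : ι → ℝ, {b | 0 ≤ v ⬝ᵥ (Mb W b *ᵥ v)}) ∩ {b | (Mb W b).det = 0}ᶜ := by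
    ext b
    simp only [Set.mem_ofPred_eq, Set.mem_inter_iff, Set.mem_iInter, Set.mem_compl_iff]
    constructor
    · intro h
      exact ⟨fun v => by simpa using h.posSemidef.dotProduct_mulVec_nonneg v, h.det_pos.ne'⟩
    · rintro ⟨h1, h2⟩
      have : (Mb W b).PosSemidef :=
        Matrix.PosSemidef.of_dotProduct_mulVec_nonneg (hH b) (fun v => by simpa using h1 v)
      exact this.posDef_iff_det_ne_zero.2 h2
  rw [this]
  refine MeasurableSet.inter (IsClosed.measurableSet ?_) (IsClosed.measurableSet ?_).compl
  · refine isClosed_iInter fun v => isClosed_le continuous_const ?_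
    exact Continuous.dotProduct continuous_const ((continuous_Mb W).matrix_mulVec continuous_const)
  · exact isClosed_eq (continuous_Mb W).matrix_det continuous_const

theorem Mb_symm (W : Matrix ι ι ℝ) (hW : W.IsSymm) (b : ι → ℝ) : (Mb W b).IsSymm := by
  unfold Mb
  exact (Matrix.isSymm_diagonal b).sub hW

/-- M-matrix positivity. -/
theorem mmatrix_nonneg (W : Matrix ι ι ℝ) (hW0 : ∀ i j, 0 ≤ W i j) (b : ι → ℝ)
    (h : (Mb W b).PosDef) (u : ι → ℝ) (hu : ∀ i, 0 ≤ (Mb W b *ᵥ u) i) : ∀ i, 0 ≤ u i := by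
  by_contra hcon
  push Not at hcon
  obtain ⟨k, hk⟩ := hcon
  set v : ι → ℝ := fun i => max (-u i) 0 with hv
  have hvne : v ≠ 0 := fun h0 => by
    have := congrFun h0 k
    simp only [hv, Pi.zero_apply] at this
    have := le_max_left (-u k) 0
    linarith
  have hpos := h.dotProduct_mulVec_pos hvne
  have h1 : 0 ≤ v ⬝ᵥ (Mb W b *ᵥ u) :=
    Finset.sum_nonneg fun i _ => mul_nonneg (le_max_right _ _) (hu i)
  have h2 : 0 ≤ - (v ⬝ᵥ (Mb W b *ᵥ (u + v))) := by
    rw [← dotProduct_neg]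
    refine Finset.sum_nonneg fun i _ => ?_
    have hs : ∀ j, 0 ≤ (u+v) j := fun j => by
      have := le_max_left (-u j) 0
      simp only [Pi.add_apply, hv]; linarith
    simp only [Mb, Matrix.sub_mulVec, Matrix.mulVec_diagonal, Pi.neg_apply, Pi.sub_apply]
    have h3 : v i * (u + v) i = 0 := by
      simp only [Pi.add_apply, hv]
      rcases le_total (-u i) 0 with h | h
      · rw [max_eq_right h]; ring
      · rw [max_eq_left h]; ring
    have h4 : 0 ≤ v i * (W *ᵥ (u+v)) i := mul_nonneg (le_max_right _ _)
      (Finset.sum_nonneg fun j _ => mul_nonneg (hW0 i j) (hs j))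
    linear_combination h4 + b i * h3
  rw [Matrix.mulVec_add, dotProduct_add] at h2
  have e : star v = v := by ext; simp
  rw [e] at hpos
  linarith

theorem inv_mulVec_eq {M : Matrix ι ι ℝ} (h : M.PosDef) {y z : ι → ℝ} (hy : M *ᵥ y = z) :
    M⁻¹ *ᵥ z = y := by
  rw [← hy, Matrix.mulVec_mulVec, Matrix.nonsing_inv_mul _ (isUnit_iff_ne_zero.2 h.det_pos.ne'),
    Matrix.one_mulVec]

theorem mul_inv_mulVec {M : Matrix ι ι ℝ} (h : M.PosDef) (z : ι → ℝ) :
    M *ᵥ (M⁻¹ *ᵥ z) = z := by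
  rw [Matrix.mulVec_mulVec, Matrix.mul_nonsing_inv _ (isUnit_iff_ne_zero.2 h.det_pos.ne'),
    Matrix.one_mulVec]

theorem inv_mulVec_pos (W : Matrix ι ι ℝ) (hW0 : ∀ i j, 0 ≤ W i j) (b : ι → ℝ)
    (h : (Mb W b).PosDef) (η : ι → ℝ) (hη : ∀ i, 0 < η i) (i : ι) : 0 < ((Mb W b)⁻¹ *ᵥ η) i := by
  set u := (Mb W b)⁻¹ *ᵥ η with hu
  have hMu : Mb W b *ᵥ u = η := mul_inv_mulVec h η
  have hn := mmatrix_nonneg W hW0 b h u (fun i => by rw [hMu]; exact (hη i).le)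
  rcases (hn i).lt_or_eq with h1 | h1
  · exact h1
  · exfalso
    have := congrFun hMu i
    simp only [Mb, Matrix.sub_mulVec, Matrix.mulVec_diagonal, Pi.sub_apply, ← h1] at this
    have h4 : 0 ≤ (W *ᵥ u) i := Finset.sum_nonneg fun j _ => mul_nonneg (hW0 i j) (hn j)
    have := hη i
    linarith

end Helpers

section Step
open scoped Matrix
set_option linter.unusedSectionVars false
variable {ι : Type} [Fintype ι] [DecidableEq ι]

/-- upper left block -/
def WA (W : Matrix (ι ⊕ Unit) (ι ⊕ Unit) ℝ) : Matrix ι ι ℝ := Matrix.of fun i j => W (.inl i) (.inl j)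
/-- off diagonal block -/
def Ww (W : Matrix (ι ⊕ Unit) (ι ⊕ Unit) ℝ) : ι → ℝ := fun i => W (.inl i) (.inr ())
/-- the shift of the last variable -/
def Wc (W : Matrix (ι ⊕ Unit) (ι ⊕ Unit) ℝ) (b : ι → ℝ) : ℝ :=
  W (.inr ()) (.inr ()) + Ww W ⬝ᵥ ((Mb (WA W) b)⁻¹ *ᵥ Ww W)

theorem WA_symm {W : Matrix (ι ⊕ Unit) (ι ⊕ Unit) ℝ} (hW : W.IsSymm) : (WA W).IsSymm := by
  ext i j; exact hW.apply _ _

theorem Mb_blocks (W : Matrix (ι ⊕ Unit) (ι ⊕ Unit) ℝ) (hW : W.IsSymm) (b : ι → ℝ) (r : ℝ) :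
    Mb W (Sum.elim b (fun _ => r)) = Matrix.fromBlocks (Mb (WA W) b)
      (-(Matrix.replicateCol Unit (Ww W))) (-(Matrix.replicateCol Unit (Ww W)))ᴴ
      (Matrix.of fun _ _ => r - W (.inr ()) (.inr ())) := by
  ext i j
  rcases i with i | i <;> rcases j with j | j
  · simp [Mb, WA, Matrix.diagonal_apply]
  · simp [Mb, Ww]
  · simp [Mb, Ww, hW.apply]
  · simp [Mb]

theorem schur_entry (W : Matrix (ι ⊕ Unit) (ι ⊕ Unit) ℝ) (b : ι → ℝ) (r : ℝ) :
    (Matrix.of (fun _ _ => r - W (.inr ()) (.inr ())) : Matrix Unit Unit ℝ) -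
      (-(Matrix.replicateCol Unit (Ww W)))ᴴ * (Mb (WA W) b)⁻¹ * (-(Matrix.replicateCol Unit (Ww W)))
    = Matrix.of (fun _ _ => r - Wc W b) := by
  ext i j
  simp only [Matrix.sub_apply, Matrix.of_apply, Wc, Matrix.mul_assoc]
  rw [Matrix.mul_neg, Matrix.conjTranspose_neg, Matrix.neg_mul, Matrix.mul_neg, neg_neg]
  simp only [Matrix.mul_apply, dotProduct, Matrix.mulVec, Matrix.conjTranspose_apply,
    Matrix.replicateCol_apply, star_trivial]
  ring

theorem det_step (W : Matrix (ι ⊕ Unit) (ι ⊕ Unit) ℝ) (hW : W.IsSymm) (b : ι → ℝ) (r : ℝ)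
    (hA : (Mb (WA W) b).PosDef) :
    (Mb W (Sum.elim b (fun _ => r))).det = (Mb (WA W) b).det * (r - Wc W b) := by
  have := hA.isUnit.invertible
  rw [Mb_blocks W hW, Matrix.det_fromBlocks₁₁, Matrix.invOf_eq_nonsing_inv, schur_entry]
  simp

theorem posDef_step (W : Matrix (ι ⊕ Unit) (ι ⊕ Unit) ℝ) (hW : W.IsSymm) (b : ι → ℝ) (r : ℝ) :
    (Mb W (Sum.elim b (fun _ => r))).PosDef ↔ (Mb (WA W) b).PosDef ∧ 0 < r - Wc W b := by
  have key : ∀ hA : (Mb (WA W) b).PosDef, (Mb W (Sum.elim b (fun _ => r))).PosSemidef ↔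
      0 ≤ r - Wc W b := by
    intro hA
    have := hA.isUnit.invertible
    rw [Mb_blocks W hW, hA.fromBlocks₁₁, schur_entry]
    constructor
    · intro h
      have := h.diag_nonneg (i := ())
      simpa using this
    · intro h
      rw [show (Matrix.of (fun _ _ => r - Wc W b) : Matrix Unit Unit ℝ)
        = Matrix.diagonal (fun _ => r - Wc W b) by ext; simp]
      exact Matrix.PosSemidef.diagonal (fun _ => h)
  constructor
  · intro h
    have hA : (Mb (WA W) b).PosDef := by
      have := h.submatrix (e := (Sum.inl : ι → ι ⊕ Unit)) Sum.inl_injective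
      convert this using 1
      ext i j
      simp [Mb, WA, Matrix.diagonal_apply]
    refine ⟨hA, lt_of_le_of_ne ((key hA).1 h.posSemidef) ?_⟩
    intro h0
    have := h.det_pos
    rw [det_step W hW b r hA, ← h0] at this
    simp at this
  · rintro ⟨hA, hs⟩
    refine ((key hA).2 hs.le).posDef_iff_det_ne_zero.2 ?_
    rw [det_step W hW b r hA]
    exact (mul_pos hA.det_pos hs).ne'

/-- the effective pinning -/
def etaHat (W : Matrix (ι ⊕ Unit) (ι ⊕ Unit) ℝ) (η : ι ⊕ Unit → ℝ) (b : ι → ℝ) : ℝ :=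
  η (.inr ()) + Ww W ⬝ᵥ ((Mb (WA W) b)⁻¹ *ᵥ (fun i => η (.inl i)))

theorem inv_step (W : Matrix (ι ⊕ Unit) (ι ⊕ Unit) ℝ) (hW : W.IsSymm) (η : ι ⊕ Unit → ℝ)
    (b : ι → ℝ) (s : ℝ) (hA : (Mb (WA W) b).PosDef) (hs : 0 < s) :
    (Mb W (Sum.elim b (fun _ => s + Wc W b)))⁻¹ *ᵥ η =
      Sum.elim ((Mb (WA W) b)⁻¹ *ᵥ (fun i => η (.inl i)) +
        (etaHat W η b / s) • ((Mb (WA W) b)⁻¹ *ᵥ Ww W)) (fun _ => etaHat W η b / s) := by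
  have hP := (posDef_step W hW b (s + Wc W b)).2 ⟨hA, by simpa using hs⟩
  apply inv_mulVec_eq hP
  rw [Mb_blocks W hW, Matrix.fromBlocks_mulVec]
  set y := etaHat W η b / s with hy
  have hys : y * s = etaHat W η b := by rw [hy]; field_simp
  ext i
  rcases i with i | i
  · simp only [Sum.elim_inl, Sum.elim_comp_inl, Sum.elim_comp_inr, Matrix.mulVec_add,
      Matrix.mulVec_smul, mul_inv_mulVec hA, Pi.add_apply, Pi.smul_apply, smul_eq_mul,
      Matrix.neg_mulVec, Pi.neg_apply]
    simp [Matrix.mulVec, dotProduct]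
    ring
  · simp only [Sum.elim_inr, Sum.elim_comp_inl, Sum.elim_comp_inr, Matrix.mulVec_add,
      Matrix.mulVec_smul, Pi.add_apply, Pi.smul_apply, smul_eq_mul,
      Matrix.conjTranspose_neg, Matrix.neg_mulVec, Pi.neg_apply]
    have e : ∀ v : ι → ℝ, ((Matrix.replicateCol Unit (Ww W))ᴴ *ᵥ v) i = Ww W ⬝ᵥ v := fun v => by
      simp [Matrix.mulVec, dotProduct]
    rw [e, e]
    have e2 : ((Matrix.of (fun _ _ => s + Wc W b - W (.inr ()) (.inr ())) : Matrix Unit Unit ℝ) *ᵥ fun _ => y) i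
      = (s + Wc W b - W (.inr ()) (.inr ())) * y := by
      simp [Matrix.mulVec, dotProduct]
    rw [e2, Wc]
    rw [etaHat] at hys
    linear_combination hys

theorem quad_step (W : Matrix (ι ⊕ Unit) (ι ⊕ Unit) ℝ) (hW : W.IsSymm) (η : ι ⊕ Unit → ℝ)
    (b : ι → ℝ) (s : ℝ) (hA : (Mb (WA W) b).PosDef) (hs : 0 < s) :
    η ⬝ᵥ ((Mb W (Sum.elim b (fun _ => s + Wc W b)))⁻¹ *ᵥ η) =
      (fun i => η (.inl i)) ⬝ᵥ ((Mb (WA W) b)⁻¹ *ᵥ (fun i => η (.inl i))) +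
        (etaHat W η b)^2 / s := by
  rw [inv_step W hW η b s hA hs]
  set η' : ι → ℝ := fun i => η (.inl i) with hη'
  have hsym : η' ⬝ᵥ ((Mb (WA W) b)⁻¹ *ᵥ Ww W) = Ww W ⬝ᵥ ((Mb (WA W) b)⁻¹ *ᵥ η') := by
    have hs : ((Mb (WA W) b)⁻¹)ᵀ = (Mb (WA W) b)⁻¹ := by
      rw [Matrix.transpose_nonsing_inv, Mb_symm _ (WA_symm hW)]
    rw [Matrix.dotProduct_mulVec, ← Matrix.mulVec_transpose, hs, dotProduct_comm]
  have e : ∀ (u : ι → ℝ) (y : ℝ), η ⬝ᵥ Sum.elim u (fun _ => y) = η' ⬝ᵥ u + η (.inr ()) * y := by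
    intro u y
    simp [dotProduct, η']
  rw [e, dotProduct_add, dotProduct_smul, hsym, smul_eq_mul]
  have : etaHat W η b = η (.inr ()) + Ww W ⬝ᵥ ((Mb (WA W) b)⁻¹ *ᵥ η') := rfl
  field_simp
  rw [this]; ring

theorem quad_add (W : Matrix (ι ⊕ Unit) (ι ⊕ Unit) ℝ) (hW : W.IsSymm) (b : ι → ℝ) (η' : ι → ℝ) :
    (η' + Ww W) ⬝ᵥ ((Mb (WA W) b)⁻¹ *ᵥ (η' + Ww W)) = η' ⬝ᵥ ((Mb (WA W) b)⁻¹ *ᵥ η') +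
      2 * (Ww W ⬝ᵥ ((Mb (WA W) b)⁻¹ *ᵥ η')) + Ww W ⬝ᵥ ((Mb (WA W) b)⁻¹ *ᵥ Ww W) := by
  have hsym : η' ⬝ᵥ ((Mb (WA W) b)⁻¹ *ᵥ Ww W) = Ww W ⬝ᵥ ((Mb (WA W) b)⁻¹ *ᵥ η') := by
    have hs : ((Mb (WA W) b)⁻¹)ᵀ = (Mb (WA W) b)⁻¹ := by
      rw [Matrix.transpose_nonsing_inv, Mb_symm _ (WA_symm hW)]
    rw [Matrix.dotProduct_mulVec, ← Matrix.mulVec_transpose, hs, dotProduct_comm]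
  rw [Matrix.mulVec_add, dotProduct_add, add_dotProduct, add_dotProduct, hsym]; ring

theorem Gd_step (W : Matrix (ι ⊕ Unit) (ι ⊕ Unit) ℝ) (hW : W.IsSymm) (η : ι ⊕ Unit → ℝ)
    (b : ι → ℝ) (s : ℝ) (hA : (Mb (WA W) b).PosDef) (hs : 0 < s) :
    Gd W η (Sum.elim b (fun _ => s + Wc W b)) =
      Gd (WA W) ((fun i => η (.inl i)) + Ww W) b * ((√(2*Real.pi))⁻¹ * Real.exp (etaHat W η b)) *
       ((√s)⁻¹ * Real.exp (-(s + (etaHat W η b)^2/s)/2)) := by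
  unfold Gd
  rw [quad_step W hW η b s hA hs, det_step W hW b _ hA, quad_add W hW]
  rw [show s + Wc W b - Wc W b = s by ring, Real.sqrt_mul hA.det_pos.le, mul_inv]
  have hc : Fintype.card (ι ⊕ Unit) = Fintype.card ι + 1 := by simp
  rw [hc, pow_succ]
  set q := Ww W ⬝ᵥ ((Mb (WA W) b)⁻¹ *ᵥ Ww W) with hq
  set p := Ww W ⬝ᵥ ((Mb (WA W) b)⁻¹ *ᵥ (fun i => η (.inl i))) with hp
  set o := (fun i => η (.inl i)) ⬝ᵥ ((Mb (WA W) b)⁻¹ *ᵥ (fun i => η (.inl i)))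
  have hexp : -(1/2) * (∑ i, (Sum.elim b (fun _ => s + Wc W b) : ι ⊕ Unit → ℝ) i - ∑ i, ∑ j, W i j)
      - (1/2) * (o + (etaHat W η b)^2 / s) + ∑ i, η i =
      (-(1/2) * (∑ i, b i - ∑ i, ∑ j, WA W i j) - (1/2) * (o + 2 * p + q)
        + ∑ i, ((fun i => η (.inl i)) + Ww W) i) + etaHat W η b + -(s + (etaHat W η b)^2/s)/2 := by
    have hw : ∀ i, W (.inr ()) (.inl i) = Ww W i := fun i => hW.apply _ _
    have hw' : ∀ i, W (.inl i) (.inr ()) = Ww W i := fun i => rfl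
    have h1 : etaHat W η b = η (.inr ()) + p := rfl
    have h2 : Wc W b = W (.inr ()) (.inr ()) + q := rfl
    simp only [Fintype.sum_sum_type, Sum.elim_inl, Sum.elim_inr, Finset.univ_unique,
      Finset.sum_singleton, Finset.sum_add_distrib, Pi.add_apply, PUnit.default_eq_unit, hw, hw', h2, WA, Matrix.of_apply]
    rw [h1]
    ring
  rw [hexp, Real.exp_add, Real.exp_add]
  ring

end Step

section Induct
open scoped Matrix
set_option linter.unusedSectionVars false
variable {ι : Type} [Fintype ι] [DecidableEq ι]

theorem lint_sum (F : (ι ⊕ Unit → ℝ) → ENNReal) (hF : Measurable F) :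
    ∫⁻ x, F x = ∫⁻ b : ι → ℝ, ∫⁻ r : ℝ, F (Sum.elim b (fun _ => r)) := by
  have h1 := (volume_measurePreserving_sumPiEquivProdPi_symm (fun _ : ι ⊕ Unit => ℝ)).lintegral_comp_emb
    (MeasurableEquiv.measurableEmbedding _) F
  rw [← h1]
  erw [lintegral_prod _ (hF.comp (MeasurableEquiv.measurable _)).aemeasurable]
  refine lintegral_congr fun b => ?_
  have h2 := ((volume_preserving_funUnique Unit ℝ).symm _).lintegral_comp_emb
    (MeasurableEquiv.measurableEmbedding _)
    (fun y => F ((MeasurableEquiv.sumPiEquivProdPi (fun _ : ι ⊕ Unit => ℝ)).symm (b, y)))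
  erw [← h2]
  refine lintegral_congr fun r => ?_
  congr 1

theorem lint_step (W : Matrix (ι ⊕ Unit) (ι ⊕ Unit) ℝ) (hW : W.IsSymm)
    (f : (ι ⊕ Unit → ℝ) → ENNReal) (hf : Measurable f) :
    ∫⁻ b in {b | (Mb W b).PosDef}, f b = ∫⁻ b in {b | (Mb (WA W) b).PosDef},
      ∫⁻ s in Set.Ioi (0:ℝ), f (Sum.elim b (fun _ => s + Wc W b)) := by
  have hS := measurableSet_posDef W hW
  rw [← lintegral_indicator hS, lint_sum _ (hf.indicator hS),
    ← lintegral_indicator (measurableSet_posDef (WA W) (WA_symm hW))]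
  refine lintegral_congr fun b => ?_
  rw [← lintegral_add_right_eq_self _ (Wc W b)]
  by_cases hb : (Mb (WA W) b).PosDef
  · rw [Set.indicator_of_mem (by exact hb), ← lintegral_indicator measurableSet_Ioi]
    refine lintegral_congr fun s => ?_
    by_cases hs : 0 < s
    · rw [Set.indicator_of_mem, Set.indicator_of_mem (by exact hs)]
      exact (posDef_step W hW b _).2 ⟨hb, by simpa using hs⟩
    · rw [Set.indicator_of_notMem, Set.indicator_of_notMem (by exact hs)]
      intro h
      exact hs (by simpa using ((posDef_step W hW b _).1 h).2)
  · rw [Set.indicator_of_notMem (by exact hb)]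
    rw [← lintegral_zero]
    refine lintegral_congr fun s => ?_
    rw [Set.indicator_of_notMem]
    intro h
    exact hb ((posDef_step W hW b _).1 h).1

theorem etaHat_pos (W : Matrix (ι ⊕ Unit) (ι ⊕ Unit) ℝ) (hW0 : ∀ i j, 0 ≤ W i j)
    (η : ι ⊕ Unit → ℝ) (hη : ∀ i, 0 < η i) (b : ι → ℝ) (hA : (Mb (WA W) b).PosDef) :
    0 < etaHat W η b := by
  refine add_pos_of_pos_of_nonneg (hη _) (Finset.sum_nonneg fun i _ => mul_nonneg (hW0 _ _) ?_)
  exact (inv_mulVec_pos (WA W) (fun i j => hW0 _ _) b hA _ (fun i => hη _) i).le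

theorem Gd_nonneg (W : Matrix ι ι ℝ) (η b : ι → ℝ) : 0 ≤ Gd W η b := by
  unfold Gd; positivity

theorem Z_step (W : Matrix (ι ⊕ Unit) (ι ⊕ Unit) ℝ) (hW : W.IsSymm) (hW0 : ∀ i j, 0 ≤ W i j)
    (η : ι ⊕ Unit → ℝ) (hη : ∀ i, 0 < η i) :
    ∫⁻ b in {b | (Mb W b).PosDef}, ENNReal.ofReal (Gd W η b) =
    ∫⁻ b in {b | (Mb (WA W) b).PosDef},
      ENNReal.ofReal (Gd (WA W) ((fun i => η (.inl i)) + Ww W) b) := by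
  rw [lint_step W hW _ (measurable_Gd W η).ennreal_ofReal]
  refine setLIntegral_congr_fun (measurableSet_posDef _ (WA_symm hW)) fun b hb => ?_
  have hb' : (Mb (WA W) b).PosDef := hb
  have ha := etaHat_pos W hW0 η hη b hb'
  have hG := Gd_nonneg (WA W) ((fun i => η (.inl i)) + Ww W) b
  have e : ∀ s ∈ Set.Ioi (0:ℝ), ENNReal.ofReal (Gd W η (Sum.elim b (fun _ => s + Wc W b))) =
      ENNReal.ofReal (Gd (WA W) ((fun i => η (.inl i)) + Ww W) b *
        ((√(2*Real.pi))⁻¹ * Real.exp (etaHat W η b))) *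
       ENNReal.ofReal ((√s)⁻¹ * Real.exp (-(s + (etaHat W η b)^2/s)/2)) := fun s hs => by
    rw [Gd_step W hW η b s hb' hs, ENNReal.ofReal_mul (by positivity)]
  rw [setLIntegral_congr_fun measurableSet_Ioi e, lintegral_const_mul _ (by fun_prop), oneD _ ha,
    ← ENNReal.ofReal_mul (by positivity)]
  congr 1
  have : √(2*Real.pi) ≠ 0 := by positivity
  rw [Real.exp_neg]; field_simp

theorem Z_step' (W : Matrix (ι ⊕ Unit) (ι ⊕ Unit) ℝ) (hW : W.IsSymm) (hW0 : ∀ i j, 0 ≤ W i j)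
    (η : ι ⊕ Unit → ℝ) (hη : ∀ i, 0 < η i) :
    ∫⁻ b in {b | (Mb W b).PosDef}, ENNReal.ofReal (Gd W η b * ((Mb W b)⁻¹ *ᵥ η) (.inr ())) =
    ∫⁻ b in {b | (Mb (WA W) b).PosDef},
      ENNReal.ofReal (Gd (WA W) ((fun i => η (.inl i)) + Ww W) b) := by
  have hm : Measurable fun b => ENNReal.ofReal (Gd W η b * ((Mb W b)⁻¹ *ᵥ η) (.inr ())) :=
    ((measurable_Gd W η).mul (measurable_invMulVec W η _)).ennreal_ofReal
  rw [lint_step W hW _ hm]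
  refine setLIntegral_congr_fun (measurableSet_posDef _ (WA_symm hW)) fun b hb => ?_
  have hb' : (Mb (WA W) b).PosDef := hb
  have ha := etaHat_pos W hW0 η hη b hb'
  have hG := Gd_nonneg (WA W) ((fun i => η (.inl i)) + Ww W) b
  have e : ∀ s ∈ Set.Ioi (0:ℝ), ENNReal.ofReal (Gd W η (Sum.elim b (fun _ => s + Wc W b)) *
        ((Mb W (Sum.elim b (fun _ => s + Wc W b)))⁻¹ *ᵥ η) (.inr ())) =
      ENNReal.ofReal (Gd (WA W) ((fun i => η (.inl i)) + Ww W) b *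
        ((√(2*Real.pi))⁻¹ * Real.exp (etaHat W η b))) *
       ENNReal.ofReal ((√s)⁻¹ * Real.exp (-(s + (etaHat W η b)^2/s)/2) * (etaHat W η b / s)) :=
    fun s hs => by
    rw [Gd_step W hW η b s hb' hs, inv_step W hW η b s hb' hs, Sum.elim_inr, mul_assoc,
      ENNReal.ofReal_mul (by positivity)]
  rw [setLIntegral_congr_fun measurableSet_Ioi e, lintegral_const_mul _ (by fun_prop), oneD' _ ha,
    ← ENNReal.ofReal_mul (by positivity)]
  congr 1
  have : √(2*Real.pi) ≠ 0 := by positivity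
  rw [Real.exp_neg]; field_simp

theorem lint_reindex {κ : Type} [Fintype κ] (e : ι ≃ κ) (f : (κ → ℝ) → ENNReal) :
    ∫⁻ b, f b = ∫⁻ b : ι → ℝ, f (fun k => b (e.symm k)) := by
  have h1 := (volume_measurePreserving_piCongrLeft (fun _ : κ => ℝ) e).lintegral_comp_emb
    (MeasurableEquiv.measurableEmbedding _) f
  rw [← h1]
  refine lintegral_congr fun b => ?_
  congr 1
  ext k
  obtain ⟨i, rfl⟩ := e.surjective k
  rw [MeasurableEquiv.coe_piCongrLeft, Equiv.piCongrLeft_apply_apply]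
  simp

theorem Mb_reindex {κ : Type} [Fintype κ] [DecidableEq κ] (e : ι ≃ κ) (W : Matrix κ κ ℝ)
    (b : ι → ℝ) : Mb W (fun k => b (e.symm k)) =
      (Mb (W.submatrix e e) b).submatrix e.symm e.symm := by
  ext i j
  simp [Mb, Matrix.diagonal_apply]

theorem inv_reindex {κ : Type} [Fintype κ] [DecidableEq κ] (e : ι ≃ κ) (W : Matrix κ κ ℝ)
    (η : κ → ℝ) (b : ι → ℝ) (i : κ) : ((Mb W (fun k => b (e.symm k)))⁻¹ *ᵥ η) i =
      ((Mb (W.submatrix e e) b)⁻¹ *ᵥ (fun i => η (e i))) (e.symm i) := by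
  rw [Mb_reindex, Matrix.inv_submatrix_equiv]
  simp only [Matrix.mulVec, dotProduct, Matrix.submatrix_apply]
  rw [← e.sum_comp]
  simp

theorem Gd_reindex {κ : Type} [Fintype κ] [DecidableEq κ] (e : ι ≃ κ) (W : Matrix κ κ ℝ)
    (η : κ → ℝ) (b : ι → ℝ) : Gd W η (fun k => b (e.symm k)) =
      Gd (W.submatrix e e) (fun i => η (e i)) b := by
  unfold Gd
  have h1 : (Mb W (fun k => b (e.symm k))).det = (Mb (W.submatrix e e) b).det := by
    rw [Mb_reindex, Matrix.det_submatrix_equiv_self]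
  have h2 : η ⬝ᵥ ((Mb W (fun k => b (e.symm k)))⁻¹ *ᵥ η) =
      (fun i => η (e i)) ⬝ᵥ ((Mb (W.submatrix e e) b)⁻¹ *ᵥ (fun i => η (e i))) := by
    simp only [dotProduct, inv_reindex]
    rw [← e.sum_comp]; simp
  have h3 : ∑ i, ∑ j, W i j = ∑ i, ∑ j, (W.submatrix e e) i j := by
    rw [← e.sum_comp]
    refine Finset.sum_congr rfl fun i _ => ?_
    rw [← e.sum_comp]; simp
  rw [h1, h2, h3, ← e.sum_comp η, ← e.sum_comp (fun k => b (e.symm k)), Fintype.card_congr e]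
  simp

theorem lint_set_reindex {κ : Type} [Fintype κ] [DecidableEq κ] (e : ι ≃ κ) (W : Matrix κ κ ℝ)
    (hW : W.IsSymm) (f : (κ → ℝ) → ENNReal) :
    ∫⁻ b in {b | (Mb W b).PosDef}, f b =
      ∫⁻ b in {b | (Mb (W.submatrix e e) b).PosDef}, f (fun k => b (e.symm k)) := by
  have hW' : (W.submatrix e e).IsSymm := hW.submatrix e
  rw [← lintegral_indicator (measurableSet_posDef W hW), lint_reindex e,
    ← lintegral_indicator (measurableSet_posDef _ hW')]
  refine lintegral_congr fun b => ?_
  have : (fun k => b (e.symm k)) ∈ {b | (Mb W b).PosDef} ↔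
      b ∈ {b | (Mb (W.submatrix e e) b).PosDef} := by
    change (Mb W (fun k => b (e.symm k))).PosDef ↔ (Mb (W.submatrix e e) b).PosDef
    rw [Mb_reindex]
    constructor
    · intro h
      have := h.submatrix (e := e) e.injective
      simpa using this
    · intro h
      exact h.submatrix e.symm.injective
  by_cases h : b ∈ {b | (Mb (W.submatrix e e) b).PosDef}
  · rw [Set.indicator_of_mem h, Set.indicator_of_mem (this.2 h)]
  · rw [Set.indicator_of_notMem h, Set.indicator_of_notMem (fun h' => h (this.1 h'))]

theorem Z_eq_one : ∀ (ι : Type) [Fintype ι] [DecidableEq ι] (W : Matrix ι ι ℝ) (_ : W.IsSymm)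
    (_ : ∀ i j, 0 ≤ W i j) (η : ι → ℝ) (_ : ∀ i, 0 < η i),
    ∫⁻ b in {b | (Mb W b).PosDef}, ENNReal.ofReal (Gd W η b) = 1 := by
  intro ι _ _
  have key : ∀ n (ι : Type) [Fintype ι] [DecidableEq ι], Fintype.card ι = n →
    ∀ (W : Matrix ι ι ℝ) (_ : W.IsSymm)
    (_ : ∀ i j, 0 ≤ W i j) (η : ι → ℝ) (_ : ∀ i, 0 < η i),
    ∫⁻ b in {b | (Mb W b).PosDef}, ENNReal.ofReal (Gd W η b) = 1 := by
    intro n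
    induction n with
    | zero =>
      intro ι _ _ hι W hW hW0 η hη
      have : IsEmpty ι := Fintype.card_eq_zero_iff.1 hι
      have hS : {b | (Mb W b).PosDef} = Set.univ := by
        ext b
        simp only [Set.mem_ofPred_eq, Set.mem_univ, iff_true]
        exact Matrix.PosDef.of_dotProduct_mulVec_pos (Subsingleton.elim _ _)
          (fun x hx => absurd (Subsingleton.elim _ _) hx)
      rw [hS, Measure.restrict_univ]
      have hG : ∀ b, Gd W η b = 1 := fun b => by
        simp [Gd, dotProduct]
      simp [hG, volume_pi]
    | succ n ih =>
      intro ι _ _ hι W hW hW0 η hη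
      have e : (Fin n ⊕ Unit) ≃ ι := Fintype.equivOfCardEq (by simp [hι])
      rw [lint_set_reindex e W hW]
      simp only [Gd_reindex]
      have hW' : (W.submatrix e e).IsSymm := hW.submatrix e
      rw [Z_step _ hW' (fun i j => hW0 _ _) _ (fun i => hη _)]
      exact ih (Fin n) (by simp) _ (WA_symm hW') (fun i j => hW0 _ _) _
        (fun i => add_pos_of_pos_of_nonneg (hη _) (hW0 _ _))
  exact key _ ι rfl

theorem Z1_eq_one (W : Matrix ι ι ℝ) (hW : W.IsSymm)
    (hW0 : ∀ i j, 0 ≤ W i j) (η : ι → ℝ) (hη : ∀ i, 0 < η i) (x : ι) :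
    ∫⁻ b in {b | (Mb W b).PosDef}, ENNReal.ofReal (Gd W η b * ((Mb W b)⁻¹ *ᵥ η) x) = 1 := by
  let e : ({y : ι // y ≠ x} ⊕ Unit) ≃ ι :=
    (Equiv.optionEquivSumPUnit _).symm.trans (Equiv.optionSubtypeNe x)
  have hx : e.symm x = .inr () := by
    rw [Equiv.symm_apply_eq]
    simp [e]
  rw [lint_set_reindex e W hW]
  simp only [Gd_reindex, inv_reindex, hx]
  have hW' : (W.submatrix e e).IsSymm := hW.submatrix e
  rw [Z_step' _ hW' (fun i j => hW0 _ _) _ (fun i => hη _)]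
  exact Z_eq_one _ _ (WA_symm hW') (fun i j => hW0 _ _) _
        (fun i => add_pos_of_pos_of_nonneg (hη _) (hW0 _ _))

end Induct

section Cov
open scoped Matrix
set_option linter.unusedSectionVars false
variable {ι : Type} [Fintype ι] [DecidableEq ι]

/-- The change of variables `t ↦ b`. -/
def Phi (W : Matrix ι ι ℝ) (η : ι → ℝ) (t : ι → ℝ) : ι → ℝ := fun j =>
  ∑ i, W j i * Real.exp (t i - t j) + η j * Real.exp (-t j)

theorem Mb_Phi_mulVec (W : Matrix ι ι ℝ) (η t : ι → ℝ) :
    Mb W (Phi W η t) *ᵥ (fun i => Real.exp (t i)) = η := by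
  ext j
  simp only [Mb, Matrix.sub_mulVec, Matrix.mulVec_diagonal, Pi.sub_apply]
  simp only [Phi, add_mul, Finset.sum_mul, Matrix.mulVec, dotProduct]
  have : ∀ i, W j i * Real.exp (t i - t j) * Real.exp (t j) = W j i * Real.exp (t i) := fun i => by
    rw [mul_assoc, ← Real.exp_add]; ring_nf
  simp only [this, mul_assoc, ← Real.exp_add]
  simp

theorem Phi_posDef (W : Matrix ι ι ℝ) (hW : W.IsSymm) (hW0 : ∀ i j, 0 ≤ W i j)
    (η : ι → ℝ) (hη : ∀ i, 0 < η i) (t : ι → ℝ) : (Mb W (Phi W η t)).PosDef := by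
  refine Matrix.PosDef.of_dotProduct_mulVec_pos ?_ fun v hv => ?_
  · rw [Matrix.IsHermitian, Matrix.conjTranspose_eq_transpose_of_trivial]
    exact Mb_symm W hW _
  have hstar : star v = v := by ext; simp
  rw [hstar]
  set E : ι → ℝ := fun i => Real.exp (t i) with hE
  have hEp : ∀ i, 0 < E i := fun i => Real.exp_pos _
  have e1 : v ⬝ᵥ (Mb W (Phi W η t) *ᵥ v) =
      ∑ j, ∑ i, W j i * (E i / E j * v j ^ 2 - v i * v j) + ∑ j, η j / E j * v j ^2 := by
    simp only [Mb, Matrix.sub_mulVec, dotProduct, Pi.sub_apply, Matrix.mulVec_diagonal]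
    simp only [Phi, dotProduct, Matrix.mulVec, ← Finset.sum_add_distrib]
    refine Finset.sum_congr rfl fun j _ => ?_
    simp only [Real.exp_sub, Real.exp_neg, hE, mul_sub, Finset.sum_sub_distrib, add_mul,
      Finset.sum_mul, mul_add, Finset.mul_sum]
    have h1 : ∀ i, v j * (W j i * (Real.exp (t i) / Real.exp (t j)) * v j) =
      W j i * (Real.exp (t i) / Real.exp (t j) * v j ^ 2) := fun i => by ring
    have h2 : ∀ i, v j * (W j i * v i) = W j i * (v i * v j) := fun i => by ring
    simp only [h1, h2]
    ring
  have e2 : 0 ≤ ∑ j, ∑ i, W j i * (E i / E j * v j ^ 2 - v i * v j) := by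
    have hswap : ∑ j, ∑ i, W j i * (E i / E j * v j ^ 2 - v i * v j) =
        ∑ j, ∑ i, W j i * (E j / E i * v i ^ 2 - v i * v j) := by
      rw [Finset.sum_comm]
      refine Finset.sum_congr rfl fun j _ => Finset.sum_congr rfl fun i _ => ?_
      rw [hW.apply]; ring
    have : 0 ≤ ∑ j, ∑ i, W j i * (E i / E j * v j ^ 2 - v i * v j) +
        ∑ j, ∑ i, W j i * (E i / E j * v j ^ 2 - v i * v j) := by
      nth_rw 2 [hswap]
      simp only [← Finset.sum_add_distrib]
      refine Finset.sum_nonneg fun j _ => Finset.sum_nonneg fun i _ => ?_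
      rw [← mul_add]
      refine mul_nonneg (hW0 _ _) ?_
      have hi := hEp i
      have hj := hEp j
      have : E i / E j * v j ^ 2 - v i * v j + (E j / E i * v i ^ 2 - v i * v j) =
        (E i * v j - E j * v i)^2 / (E i * E j) := by field_simp; ring
      rw [this]; positivity
    linarith
  have e3 : 0 < ∑ j, η j / E j * v j ^2 := by
    obtain ⟨k, hk⟩ := Function.ne_iff.1 hv
    refine Finset.sum_pos' (fun j _ => ?_) ⟨k, Finset.mem_univ _, ?_⟩
    · have := hη j; have := hEp j; positivity
    · have := hη k; have := hEp k
      have : v k ≠ 0 := hk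
      positivity
  rw [e1]; linarith

theorem inv_Phi (W : Matrix ι ι ℝ) (hW : W.IsSymm) (hW0 : ∀ i j, 0 ≤ W i j)
    (η : ι → ℝ) (hη : ∀ i, 0 < η i) (t : ι → ℝ) :
    (Mb W (Phi W η t))⁻¹ *ᵥ η = fun i => Real.exp (t i) :=
  inv_mulVec_eq (Phi_posDef W hW hW0 η hη t) (Mb_Phi_mulVec W η t)

theorem Phi_inj (W : Matrix ι ι ℝ) (hW : W.IsSymm) (hW0 : ∀ i j, 0 ≤ W i j)
    (η : ι → ℝ) (hη : ∀ i, 0 < η i) : Function.Injective (Phi W η) := by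
  intro t t' h
  have h1 := inv_Phi W hW hW0 η hη t
  rw [h, inv_Phi W hW hW0 η hη t'] at h1
  ext i
  exact (Real.exp_injective (congrFun h1 i)).symm

theorem Phi_range (W : Matrix ι ι ℝ) (hW : W.IsSymm) (hW0 : ∀ i j, 0 ≤ W i j)
    (η : ι → ℝ) (hη : ∀ i, 0 < η i) : Set.range (Phi W η) = {b | (Mb W b).PosDef} := by
  ext b
  constructor
  · rintro ⟨t, rfl⟩
    exact Phi_posDef W hW hW0 η hη t
  · intro hb
    have hb' : (Mb W b).PosDef := hb
    have hp := inv_mulVec_pos W hW0 b hb' η hη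
    set u := (Mb W b)⁻¹ *ᵥ η with hu
    have hMu : Mb W b *ᵥ u = η := mul_inv_mulVec hb' η
    refine ⟨fun i => Real.log (u i), ?_⟩
    ext j
    have h1 := congrFun hMu j
    simp only [Mb, Matrix.sub_mulVec, Matrix.mulVec_diagonal, Pi.sub_apply] at h1
    simp only [Phi, Real.exp_sub, Real.exp_neg, Real.exp_log (hp _)]
    have h2 : ∑ i, W j i * (u i / u j) = (W *ᵥ u) j / u j := by
      simp only [Matrix.mulVec, dotProduct, Finset.sum_div, mul_div_assoc]
    have := (hp j).ne'
    rw [h2, ← h1]; field_simp; ring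

/-- The Jacobian matrix. -/
def Jac (W : Matrix ι ι ℝ) (η t : ι → ℝ) : Matrix ι ι ℝ :=
  -(Matrix.diagonal (fun i => Real.exp (-t i)) * Mb W (Phi W η t) *
    Matrix.diagonal (fun i => Real.exp (t i)))

theorem Jac_det (W : Matrix ι ι ℝ) (hW : W.IsSymm) (hW0 : ∀ i j, 0 ≤ W i j)
    (η : ι → ℝ) (hη : ∀ i, 0 < η i) (t : ι → ℝ) :
    |(Jac W η t).det| = (Mb W (Phi W η t)).det := by
  have := (Phi_posDef W hW hW0 η hη t).det_pos
  rw [Jac, Matrix.det_neg, Matrix.det_mul, Matrix.det_mul, Matrix.det_diagonal,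
    Matrix.det_diagonal, abs_mul, abs_pow, abs_neg, abs_one, one_pow, one_mul]
  rw [mul_right_comm, ← Finset.prod_mul_distrib]
  simp only [← Real.exp_add]
  simp [abs_of_pos this]

theorem Phi_hasFDerivAt (W : Matrix ι ι ℝ) (η t : ι → ℝ) :
    HasFDerivAt (Phi W η) (LinearMap.toContinuousLinearMap (Matrix.toLin' (Jac W η t))) t := by
  rw [hasFDerivAt_pi']
  intro j
  have hp : ∀ i, HasFDerivAt (fun t : ι → ℝ => t i) (ContinuousLinearMap.proj (R := ℝ) i) t :=
    fun i => hasFDerivAt_apply i t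
  have h1 : HasFDerivAt (fun t : ι → ℝ => ∑ i, W j i * Real.exp (t i - t j) + η j * Real.exp (-t j))
      (∑ i, W j i • Real.exp (t i - t j) • (ContinuousLinearMap.proj (R := ℝ) (φ := fun _ : ι => ℝ) i
        - ContinuousLinearMap.proj j) + η j • Real.exp (-t j) •
          (-ContinuousLinearMap.proj (R := ℝ) (φ := fun _ : ι => ℝ) j)) t := by
    refine HasFDerivAt.add (HasFDerivAt.fun_sum fun i _ => ?_) ?_
    · exact (((hp i).sub (hp j)).exp).const_mul _
    · exact ((hp j).neg.exp).const_mul _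
  refine HasFDerivAt.congr_fderiv h1 ?_
  ext v
  simp only [_root_.add_apply, _root_.sum_apply,
    _root_.smul_apply, _root_.sub_apply, _root_.neg_apply,
    ContinuousLinearMap.proj_apply, ContinuousLinearMap.comp_apply, smul_eq_mul,
    LinearMap.coe_toContinuousLinearMap', Matrix.toLin'_apply]
  simp only [Jac, Matrix.neg_mulVec, Pi.neg_apply, ← Matrix.mulVec_mulVec, Matrix.mulVec_diagonal,
    Mb, Matrix.sub_mulVec, Pi.sub_apply]
  have h3 : Real.exp (-t j) * (W *ᵥ ((Matrix.diagonal fun i => Real.exp (t i)) *ᵥ v)) j =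
      ∑ i, W j i * Real.exp (t i - t j) * v i := by
    rw [Matrix.mulVec, dotProduct, Finset.mul_sum]
    refine Finset.sum_congr rfl fun i _ => ?_
    rw [Matrix.mulVec_diagonal, Real.exp_sub, Real.exp_neg]; field_simp
  have h4 : Real.exp (-t j) * Real.exp (t j) = 1 := by rw [← Real.exp_add]; simp
  have h5 : ∑ i, W j i * (Real.exp (t i - t j) * (v i - v j)) =
      ∑ i, W j i * Real.exp (t i - t j) * v i - (∑ i, W j i * Real.exp (t i - t j)) * v j := by
    rw [Finset.sum_mul, ← Finset.sum_sub_distrib]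
    refine Finset.sum_congr rfl fun i _ => by ring
  rw [h5, mul_sub, h3, Phi]
  linear_combination ((∑ i, W j i * Real.exp (t i - t j) + η j * Real.exp (-t j)) * v j) * h4

theorem cov (W : Matrix ι ι ℝ) (hW : W.IsSymm) (hW0 : ∀ i j, 0 ≤ W i j)
    (η : ι → ℝ) (hη : ∀ i, 0 < η i) (g : (ι → ℝ) → ENNReal) :
    ∫⁻ b in {b | (Mb W b).PosDef}, g b =
      ∫⁻ t, ENNReal.ofReal (Mb W (Phi W η t)).det * g (Phi W η t) := by
  have h := lintegral_image_eq_lintegral_abs_det_fderiv_mul volume (s := Set.univ)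
    MeasurableSet.univ (fun t _ => (Phi_hasFDerivAt W η t).hasFDerivWithinAt)
    (Phi_inj W hW hW0 η hη).injOn g
  rw [Set.image_univ, Phi_range W hW hW0 η hη, Measure.restrict_univ] at h
  rw [h]
  refine lintegral_congr fun t => ?_
  rw [LinearMap.det_toContinuousLinearMap, LinearMap.det_toLin', Jac_det W hW hW0 η hη]

theorem t_space (W : Matrix ι ι ℝ) (hW : W.IsSymm) (hW0 : ∀ i j, 0 ≤ W i j)
    (η : ι → ℝ) (hη : ∀ i, 0 < η i) (x : ι) :
    ∫⁻ t, ENNReal.ofReal (√(Mb W (Phi W η t)).det * Real.exp (t x) *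
      (√(2*Real.pi))⁻¹ ^ (Fintype.card ι) *
      Real.exp (-(1/2) * (∑ i, Phi W η t i - ∑ i, ∑ j, W i j) -
        (1/2) * (∑ i, η i * Real.exp (t i)) + ∑ i, η i)) = 1 := by
  rw [← Z1_eq_one W hW hW0 η hη x, cov W hW hW0 η hη]
  refine lintegral_congr fun t => ?_
  have hd := (Phi_posDef W hW hW0 η hη t).det_pos
  rw [← ENNReal.ofReal_mul hd.le, Gd, inv_Phi W hW hW0 η hη]
  congr 1
  have h2 : (Mb W (Phi W η t)).det * (√(Mb W (Phi W η t)).det)⁻¹ = √(Mb W (Phi W η t)).det := by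
    have := Real.mul_self_sqrt hd.le
    have := (Real.sqrt_pos.2 hd).ne'
    field_simp; nlinarith
  conv_lhs => rw [← h2]
  simp only [dotProduct]
  ring

end Cov

section Final
open scoped Matrix
set_option linter.unusedSectionVars false

/-- The edge weights. -/
def Wt {L : ℕ} (β : ℝ) : Matrix (Torus L) (Torus L) ℝ := Matrix.of fun j k => if NN j k then β else 0

theorem NN_symm {L : ℕ} {x y : Torus L} (h : NN x y) : NN y x := by
  obtain ⟨h1, i, h2 | h2⟩ := h
  · exact ⟨h1.symm, i, Or.inr (by rw [h2]; simp)⟩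
  · exact ⟨h1.symm, i, Or.inl (by rw [h2]; simp)⟩

theorem NN_comm {L : ℕ} {x y : Torus L} : NN x y ↔ NN y x := ⟨NN_symm, NN_symm⟩

theorem Wt_symm {L : ℕ} (β : ℝ) : (Wt (L := L) β).IsSymm := by
  ext i j
  simp [Wt, NN_comm (x := i)]

theorem Wt_nonneg {L : ℕ} (β : ℝ) (hβ : 0 < β) (i j : Torus L) : 0 ≤ Wt β i j := by
  simp only [Wt, Matrix.of_apply]
  split_ifs <;> linarith

variable {L : ℕ} [NeZero L]

theorem Dmat_eq (β ε : ℝ) (t : Torus L → ℝ) :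
    Dmat β ε t = Matrix.diagonal (fun i => Real.exp (t i)) * Mb (Wt β) (Phi (Wt β) (fun _ => ε) t) *
      Matrix.diagonal (fun i => Real.exp (t i)) := by
  ext j k
  rw [Matrix.mul_diagonal, Matrix.diagonal_mul]
  by_cases h : j = k
  · subst h
    have hn : ¬ NN j j := fun h => h.1 rfl
    simp only [Dmat, Mb, Wt, Matrix.of_apply, if_true, Matrix.sub_apply, Matrix.diagonal_apply_eq, hn,
      if_false, sub_zero, Phi]
    rw [mul_add, add_mul, Finset.mul_sum, Finset.mul_sum, Finset.sum_mul]
    congr 1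
    · refine Finset.sum_congr rfl fun i _ => ?_
      rw [NN_comm (x := i)]
      split_ifs
      · rw [Real.exp_sub, Real.exp_add]; field_simp
      · simp
    · rw [Real.exp_neg]; field_simp
  · simp only [Dmat, Mb, Wt, Matrix.of_apply, h, if_false, Matrix.sub_apply,
      Matrix.diagonal_apply_ne _ h, zero_sub]
    split_ifs
    · rw [Real.exp_add]; ring
    · simp

theorem Dmat_inv (β ε : ℝ) (hβ : 0 < β) (hε : 0 < ε) (t : Torus L → ℝ) (x y : Torus L) :
    Real.exp (t x + t y) * (Dmat β ε t)⁻¹ x y =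
      (Mb (Wt β) (Phi (Wt β) (fun _ => ε) t))⁻¹ x y := by
  have hP := Phi_posDef (Wt β) (Wt_symm β) (Wt_nonneg (L := L) β hβ) (fun _ => ε) (fun _ => hε) t
  set M := Mb (Wt β) (Phi (Wt β) (fun _ => ε) t) with hM
  have hd : Matrix.diagonal (fun i => Real.exp (t i)) * Matrix.diagonal (fun i => Real.exp (-t i)) = 1 := by
    rw [Matrix.diagonal_mul_diagonal]
    simp [← Real.exp_add]
  have hinv : (Dmat β ε t)⁻¹ = Matrix.diagonal (fun i => Real.exp (-t i)) * M⁻¹ *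
      Matrix.diagonal (fun i => Real.exp (-t i)) := by
    apply Matrix.inv_eq_right_inv
    rw [Dmat_eq, ← hM]
    calc _ = Matrix.diagonal (fun i => Real.exp (t i)) * M *
        (Matrix.diagonal (fun i => Real.exp (t i)) * Matrix.diagonal (fun i => Real.exp (-t i))) * M⁻¹ *
         Matrix.diagonal (fun i => Real.exp (-t i)) := by simp only [Matrix.mul_assoc]
      _ = Matrix.diagonal (fun i => Real.exp (t i)) * (M * M⁻¹) *
         Matrix.diagonal (fun i => Real.exp (-t i)) := by
          rw [hd, Matrix.mul_one]; simp only [Matrix.mul_assoc]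
      _ = 1 := by
          rw [Matrix.mul_nonsing_inv _ (isUnit_iff_ne_zero.2 hP.det_pos.ne'), Matrix.mul_one, hd]
  rw [hinv, Matrix.mul_diagonal, Matrix.diagonal_mul, Real.exp_add, Real.exp_neg, Real.exp_neg]
  field_simp

theorem exp_freeEnergy (β ε : ℝ) (hβ : 0 < β) (hε : 0 < ε) (t : Torus L → ℝ) :
    Real.exp (-(freeEnergy β ε t)) = √(Mb (Wt β) (Phi (Wt β) (fun _ => ε) t)).det *
      Real.exp (-(1/2) * (∑ i, Phi (Wt β) (fun _ => ε) t i - ∑ i, ∑ j, Wt (L := L) β i j) -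
        (1/2) * (∑ i, ε * Real.exp (t i)) + ∑ _i : Torus L, ε) := by
  have hP := Phi_posDef (Wt β) (Wt_symm β) (Wt_nonneg (L := L) β hβ) (fun _ => ε) (fun _ => hε) t
  have hdet : (Dmat β ε t).det = (Mb (Wt β) (Phi (Wt β) (fun _ => ε) t)).det *
      (Real.exp (∑ i, t i)) ^ 2 := by
    rw [Dmat_eq, Matrix.det_mul, Matrix.det_mul, Matrix.det_diagonal, Real.exp_sum]; ring
  have hlog : (1/2) * Real.log (Dmat β ε t).det =
      Real.log √(Mb (Wt β) (Phi (Wt β) (fun _ => ε) t)).det + ∑ i, t i := by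
    rw [hdet, Real.log_mul hP.det_pos.ne' (by positivity), Real.log_pow, Real.log_exp,
      Real.log_sqrt hP.det_pos.le]
    push_cast; ring
  have hPhi : ∑ i, Phi (Wt β) (fun _ => ε) t i =
      ∑ i, ∑ j, Wt β i j * Real.cosh (t i - t j) + ∑ i, ε * Real.exp (-t i) := by
    simp only [Phi, Finset.sum_add_distrib]
    congr 1
    have hswap : ∑ i, ∑ j, Wt β i j * Real.exp (t j - t i) =
        ∑ i, ∑ j, Wt β i j * Real.exp (-(t j - t i)) := by
      rw [Finset.sum_comm]
      refine Finset.sum_congr rfl fun j _ => Finset.sum_congr rfl fun i _ => ?_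
      rw [(Wt_symm β).apply, neg_sub]
    have h2 : ∑ i, ∑ j, Wt β i j * Real.cosh (t i - t j) =
       (1/2) * (∑ i, ∑ j, Wt β i j * Real.exp (t j - t i)) +
        (1/2) * ∑ i, ∑ j, Wt β i j * Real.exp (-(t j - t i)) := by
      simp only [Finset.mul_sum, ← Finset.sum_add_distrib]
      refine Finset.sum_congr rfl fun j _ => Finset.sum_congr rfl fun i _ => ?_
      rw [← Real.cosh_neg, neg_sub, Real.cosh_eq]; ring
    rw [h2, ← hswap]; ring
  have hnn : β * nnSum (fun i j => Real.cosh (t i - t j) - 1) =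
      (1/2) * (∑ i, ∑ j, Wt β i j * Real.cosh (t i - t j) - ∑ i, ∑ j, Wt (L := L) β i j) := by
    simp only [nnSum, Finset.mul_sum, ← Finset.sum_sub_distrib]
    refine Finset.sum_congr rfl fun j _ => Finset.sum_congr rfl fun i _ => ?_
    simp only [Wt, Matrix.of_apply]
    split_ifs <;> ring
  have hk : ∑ k : Torus L, (t k - ε + ε * Real.cosh (t k)) = ∑ k, t k - ∑ _k : Torus L, ε +
      (1/2) * ∑ i, ε * Real.exp (t i) + (1/2) * ∑ i, ε * Real.exp (-t i) := by
    simp only [Finset.mul_sum, ← Finset.sum_add_distrib, ← Finset.sum_sub_distrib]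
    refine Finset.sum_congr rfl fun k _ => ?_
    rw [Real.cosh_eq]; ring
  have hs := Real.sqrt_pos.2 hP.det_pos
  rw [freeEnergy, hlog, hnn, hk, hPhi]
  conv_rhs => rw [← Real.exp_log hs, ← Real.exp_add]
  congr 1
  ring

/-- The sum rule, for a general side length. -/
theorem sum_rule_aux (β ε : ℝ) (hβ : 0 < β) (hε : 0 < ε) (x : Torus L) :
    ∑ y : Torus L,
        expect β ε (fun t => Real.exp (t x + t y) * (Dmat β ε t)⁻¹ x y) = 1 / ε := by
  have hW := Wt_symm (L := L) β
  have hW0 := Wt_nonneg (L := L) β hβ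
  have hη : ∀ i : Torus L, 0 < (fun _ => ε : Torus L → ℝ) i := fun _ => hε
  set W : Matrix (Torus L) (Torus L) ℝ := Wt β with hWdef
  set M : (Torus L → ℝ) → Matrix (Torus L) (Torus L) ℝ := fun t => Mb W (Phi W (fun _ => ε) t) with hM
  set K : (Torus L → ℝ) → ℝ := fun t => √(M t).det * (√(2*Real.pi))⁻¹ ^ (Fintype.card (Torus L)) *
      Real.exp (-(1/2) * (∑ i, Phi W (fun _ => ε) t i - ∑ i, ∑ j, W i j) -
        (1/2) * (∑ i, ε * Real.exp (t i)) + ∑ _i : Torus L, ε) with hK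
  have hPhiC : Continuous (Phi W (fun _ => ε)) := by
    unfold Phi; fun_prop
  have hMC : Continuous M := (continuous_Mb W).comp hPhiC
  have hKC : Continuous K := by
    have := hMC.matrix_det
    have h2 : ∀ i, Continuous fun t => Phi W (fun _ => ε) t i := fun i => (continuous_apply i).comp hPhiC
    fun_prop
  have hK0 : ∀ t, 0 ≤ K t := fun t => by positivity
  have hint1 : ∫⁻ t, ENNReal.ofReal (K t * Real.exp (t x)) = 1 := by
    rw [← t_space W hW hW0 (fun _ => ε) hη x]
    refine lintegral_congr fun t => ?_
    congr 1
    simp only [hK, hM]; ring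
  have hH0 : ∀ t, 0 ≤ K t * Real.exp (t x) := fun t => mul_nonneg (hK0 t) (Real.exp_pos _).le
  have hHm : AEStronglyMeasurable (fun t => K t * Real.exp (t x)) volume :=
    (hKC.mul (by fun_prop)).aestronglyMeasurable
  have hHi : Integrable (fun t => K t * Real.exp (t x)) := by
    refine ⟨hHm, ?_⟩
    rw [hasFiniteIntegral_iff_ofReal (Filter.Eventually.of_forall hH0), hint1]
    exact ENNReal.one_lt_top
  have hHint : ∫ t, K t * Real.exp (t x) = 1 := by
    rw [integral_eq_lintegral_of_nonneg_ae (Filter.Eventually.of_forall hH0) hHm, hint1]; simp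
  have hsum : ∀ t, ∑ y, (M t)⁻¹ x y = Real.exp (t x) / ε := fun t => by
    have := congrFun (inv_Phi W hW hW0 (fun _ => ε) hη t) x
    simp only [Matrix.mulVec, dotProduct, ← Finset.sum_mul] at this
    rw [← this]; field_simp; rfl
  have hnn : ∀ t y, 0 ≤ (M t)⁻¹ x y := fun t y => by
    have hP := Phi_posDef W hW hW0 (fun _ => ε) hη t
    have := mmatrix_nonneg W hW0 _ hP ((M t)⁻¹ *ᵥ Pi.single y 1) (fun i => by
      rw [mul_inv_mulVec hP]
      by_cases h : i = y
      · subst h; simp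
      · simp [h]) x
    simpa using this
  have hex : ∀ y, expect β ε (fun t => Real.exp (t x + t y) * (Dmat β ε t)⁻¹ x y) =
      ∫ t, (M t)⁻¹ x y * K t := fun y => by
    unfold expect
    congr 1
    ext t
    beta_reduce
    rw [Dmat_inv β ε hβ hε, exp_freeEnergy β ε hβ hε]
    simp only [hK, hM]; ring
  have hi : ∀ y, Integrable (fun t => (M t)⁻¹ x y * K t) := fun y => by
    refine (hHi.div_const ε).mono' ?_ (Filter.Eventually.of_forall fun t => ?_)
    · exact ((measurable_inv_entry M hMC x y).mul hKC.measurable).aestronglyMeasurable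
    · rw [Real.norm_of_nonneg (mul_nonneg (hnn t y) (hK0 t)), mul_div_assoc, ← hsum t, mul_comm]
      exact mul_le_mul_of_nonneg_left
        (Finset.single_le_sum (f := fun y => (M t)⁻¹ x y) (fun i _ => hnn t i) (Finset.mem_univ y)) (hK0 t)
  simp only [hex]
  rw [← integral_finsetSum _ (fun y _ => hi y)]
  simp only [← Finset.sum_mul, hsum]
  rw [← hHint, ← integral_div]
  congr 1
  ext t
  ring

end Final

/-- **Sum rule (Ward identity of the hyperbolic symmetry).** For every `β > 0`, `ε > 0`,
torus side `L ≥ 2` and site `x`, `∑_y ⟨e^{t_x+t_y} (D_{β,ε}(t)⁻¹)_{xy}⟩ = 1/ε`. -/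
theorem sum_rule (β ε : ℝ) (hβ : 0 < β) (hε : 0 < ε) (L : ℕ) (x : Torus (L + 2)) :
    ∑ y : Torus (L + 2),
        expect β ε (fun t => Real.exp (t x + t y) * (Dmat β ε t)⁻¹ x y) = 1 / ε := by
  exact sum_rule_aux β ε hβ hε x

end
end
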